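/- For all n ≥ 4511 and every even integer m with n+1 ≤ m ≤ 2n−4008, the Ramsey number R(K_{2,n}, C_m) equals 2n; that is, every graph on 2n vertices either contains K_{2,n} as a subgraph or its complement contains a cycle of length m, and there is a graph on 2n−1 vertices witnessing that 2n−1 does not suffice. -/

import Mathlib

open SimpleGraph

/-- `G` contains `H` as a (not necessarily induced) subgraph. -/
def Contains {V W : Type*} (G : SimpleGraph V) (H : SimpleGraph W) : Prop :=
  ∃ f : H →g G, Function.Injective f

/-- `G` has a cycle with `m` vertices (equivalently, of length `m`). -/
def HasCycleLength {V : Type*} (G : SimpleGraph V) (m : ℕ) : Prop :=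
  ∃ (v : V) (c : G.Walk v v), c.IsCycle ∧ c.length = m

/-- The Ramsey property for `K_{a,b}` versus the cycle `C_m`: every graph `Γ` on `N` vertices
contains `K_{a,b}`, or its complement contains a cycle of length `m`. -/
def RamseyProp (a b m N : ℕ) : Prop :=
  ∀ Γ : SimpleGraph (Fin N),
    Contains Γ (completeBipartiteGraph (Fin a) (Fin b)) ∨ HasCycleLength Γᶜ m

/-- `G` is `k`-connected. -/
def IsKConnected {V : Type*} [Fintype V] (k : ℕ) (G : SimpleGraph V) : Prop :=
  k < Fintype.card V ∧
    ∀ S : Finset V, S.card < k → (G.induce ((↑S : Set V)ᶜ)).Connected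

/-- The circumference of `G`: the length of a longest cycle. -/
noncomputable def circumference {V : Type*} (G : SimpleGraph V) : ℕ :=
  sSup {m | HasCycleLength G m}

set_option linter.unusedSectionVars false

section PathLists

variable {V : Type*} {G : SimpleGraph V} {W W' : Finset V} {a b c d u v x y z : V}
  {l l' p : List V} {i j k : ℕ}

/-- `l` lists the vertices of a path of `G` from `a` to `b` inside `W`. -/
structure IsPathList (G : SimpleGraph V) (W : Finset V) (a b : V) (l : List V) : Prop where
  chain : l.IsChain G.Adj
  nodup : l.Nodup
  mem : ∀ x ∈ l, x ∈ W
  head : l.head? = some a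
  last : l.getLast? = some b

/-- The entries of `l` in positions `i, …, j`. -/
def slice (l : List V) (i j : ℕ) : List V := (l.take (j + 1)).drop i

theorem getElem?_slice (l : List V) (i j k : ℕ) :
    (slice l i j)[k]? = if i + k ≤ j then l[i + k]? else none := by
  simp only [slice, List.getElem?_drop, List.getElem?_take, Nat.lt_succ_iff]

theorem mem_slice : z ∈ slice l i j ↔ ∃ k, i ≤ k ∧ k ≤ j ∧ l[k]? = some z := by
  rw [List.mem_iff_getElem?]
  simp only [getElem?_slice]
  constructor
  · rintro ⟨k, hk⟩
    split_ifs at hk with h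
    exact ⟨i + k, by omega, h, hk⟩
  · rintro ⟨k, h1, h2, h3⟩
    refine ⟨k - i, ?_⟩
    rw [show i + (k - i) = k by omega, if_pos h2, h3]

theorem length_slice (hj : j < l.length) : (slice l i j).length = j + 1 - i := by
  simp only [slice, List.length_drop, List.length_take]
  omega

theorem lt_length_of_getElem?_eq (h : l[i]? = some x) : i < l.length :=
  (List.getElem?_eq_some_iff.1 h).1

theorem List.Nodup.index_eq (hl : l.Nodup) (hi : l[i]? = some x) (hj : l[j]? = some x) :
    i = j :=
  (List.getElem?_inj (lt_length_of_getElem?_eq hi) hl).1 (hi.trans hj.symm)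

theorem slice_disjoint (hl : l.Nodup) {i' j' : ℕ} (h : j < i' ∨ j' < i) :
    ∀ x ∈ slice l i j, x ∉ slice l i' j' := by
  intro x hx hx'
  obtain ⟨k, h1, h2, h3⟩ := mem_slice.1 hx
  obtain ⟨k', h1', h2', h3'⟩ := mem_slice.1 hx'
  have := hl.index_eq h3 h3'
  omega

namespace IsPathList

theorem getElem?_zero (h : IsPathList G W a b l) : l[0]? = some a := by
  rw [← List.head?_eq_getElem?, h.head]

theorem ne_nil (h : IsPathList G W a b l) : l ≠ [] := by
  rintro rfl
  simpa using h.head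

theorem length_pos (h : IsPathList G W a b l) : 0 < l.length :=
  List.length_pos_iff.2 h.ne_nil

theorem getElem?_last (h : IsPathList G W a b l) : l[l.length - 1]? = some b := by
  rw [← List.getLast?_eq_getElem?, h.last]

theorem head_mem (h : IsPathList G W a b l) : a ∈ l :=
  List.mem_of_getElem? h.getElem?_zero

theorem last_mem (h : IsPathList G W a b l) : b ∈ l :=
  List.mem_of_getElem? h.getElem?_last

theorem mono (h : IsPathList G W a b l) (hW : ∀ x ∈ l, x ∈ W') : IsPathList G W' a b l :=
  ⟨h.chain, h.nodup, hW, h.head, h.last⟩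

theorem singleton (G : SimpleGraph V) (ha : a ∈ W) : IsPathList G W a a [a] :=
  ⟨by simp, by simp, by simpa using ha, by simp, by simp⟩

theorem reverse (h : IsPathList G W a b l) : IsPathList G W b a l.reverse := by
  refine ⟨?_, by simpa using h.nodup, by simpa using h.mem, by simpa using h.last,
    by simpa using h.head⟩
  rw [List.isChain_reverse]
  exact h.chain.imp fun _ _ e => e.symm

theorem append (h : IsPathList G W a b l) (h' : IsPathList G W c d l') (hbc : G.Adj b c)
    (hd : ∀ x ∈ l, x ∉ l') : IsPathList G W a d (l ++ l') := by
  refine ⟨?_, ?_, ?_, ?_, ?_⟩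
  · rw [List.isChain_append]
    refine ⟨h.chain, h'.chain, ?_⟩
    intro x hx y hy
    rw [h.last] at hx
    rw [h'.head] at hy
    simp only [Option.mem_def, Option.some.injEq] at hx hy
    subst hx hy
    exact hbc
  · rw [List.nodup_append]
    refine ⟨h.nodup, h'.nodup, ?_⟩
    rintro x hx y hy rfl
    exact hd x hx hy
  · intro x hx
    rcases List.mem_append.1 hx with hx | hx
    exacts [h.mem x hx, h'.mem x hx]
  · simp [List.head?_append, h.head]
  · simp [List.getLast?_append, h'.last]

theorem slice (h : IsPathList G W a b l) (hi : l[i]? = some x) (hj : l[j]? = some y)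
    (hij : i ≤ j) : IsPathList G W x y (slice l i j) := by
  have hjl := lt_length_of_getElem?_eq hj
  refine ⟨(h.chain.take _).drop _, ?_, ?_, ?_, ?_⟩
  · exact h.nodup.sublist ((List.drop_sublist _ _).trans (List.take_sublist _ _))
  · intro z hz
    obtain ⟨k, -, -, hk⟩ := mem_slice.1 hz
    exact h.mem z (List.mem_of_getElem? hk)
  · rw [List.head?_eq_getElem?, getElem?_slice]
    simp [hij, hi]
  · rw [List.getLast?_eq_getElem?, getElem?_slice, length_slice hjl]
    rw [if_pos (by omega), show i + (j + 1 - i - 1) = j by omega, hj]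

theorem adj (h : IsPathList G W a b l) (hi : l[i]? = some x) (hj : l[i + 1]? = some y) :
    G.Adj x y := by
  obtain ⟨h1, rfl⟩ := List.getElem?_eq_some_iff.1 hi
  obtain ⟨h2, rfl⟩ := List.getElem?_eq_some_iff.1 hj
  exact List.isChain_iff_getElem.1 h.chain i h2

/-- Replace the part of a path strictly between positions `i < j` by another path. -/
theorem splice (h : IsPathList G W a b l) (hi : l[i]? = some x) (hj : l[j]? = some y)
    (hij : i < j) (hp : IsPathList G W u v p) (hpl : ∀ z ∈ p, z ∉ l) (hxu : G.Adj x u)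
    (hvy : G.Adj v y) :
    ∃ l', IsPathList G W a b l' ∧ l'.length + j = i + 1 + p.length + l.length := by
  have hjl := lt_length_of_getElem?_eq hj
  have h1 := h.slice h.getElem?_zero hi (Nat.zero_le i)
  have h2 := h.slice hj h.getElem?_last (by omega)
  refine ⟨_, h1.append (hp.append h2 hvy ?_) hxu ?_, ?_⟩
  · intro z hz hz'
    obtain ⟨k, -, -, hk⟩ := mem_slice.1 hz'
    exact hpl z hz (List.mem_of_getElem? hk)
  · intro z hz hz'
    rcases List.mem_append.1 hz' with hz' | hz'
    · obtain ⟨k, -, -, hk⟩ := mem_slice.1 hz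
      exact hpl z hz' (List.mem_of_getElem? hk)
    · exact slice_disjoint h.nodup (by omega) z hz hz'
  · rw [List.length_append, List.length_append, length_slice (by omega), length_slice (by omega)]
    omega

/-- If `u` is joined to positions `i` and `j > i`, and `v` to the next positions, then a path
can be rerouted through both. -/
theorem cross (h : IsPathList G W a b l) {x' y' : V} (hi : l[i]? = some x)
    (hi' : l[i + 1]? = some x') (hj : l[j]? = some y) (hj' : l[j + 1]? = some y') (hij : i < j)
    (hu : u ∈ W) (hv : v ∈ W) (hul : u ∉ l) (hvl : v ∉ l) (huv : u ≠ v)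
    (h1 : G.Adj u x) (h2 : G.Adj u y) (h3 : G.Adj v x') (h4 : G.Adj v y') :
    ∃ l', IsPathList G W a b l' ∧ l'.length = l.length + 2 := by
  have hjl := lt_length_of_getElem?_eq hj'
  have s1 := h.slice h.getElem?_zero hi (Nat.zero_le i)
  have s2 := (h.slice hi' hj (by omega)).reverse
  have s3 := h.slice hj' h.getElem?_last (by omega)
  have hsl : ∀ {z i j}, z ∈ _root_.slice l i j → z ∈ l := by
    intro z i j hz
    obtain ⟨k, -, -, hk⟩ := mem_slice.1 hz
    exact List.mem_of_getElem? hk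
  have t1 := (singleton G hv).append s3 h4 (by
    intro z hz hz'
    obtain rfl := List.mem_singleton.1 hz
    exact hvl (hsl hz'))
  have t2 := s2.append t1 h3.symm (by
    intro z hz hz'
    rw [List.mem_reverse] at hz
    rcases List.mem_append.1 hz' with hz' | hz'
    · obtain rfl := List.mem_singleton.1 hz'
      exact hvl (hsl hz)
    · exact slice_disjoint h.nodup (by omega) z hz hz')
  have t3 := (singleton G hu).append t2 h2 (by
    intro z hz hz'
    obtain rfl := List.mem_singleton.1 hz
    rcases List.mem_append.1 hz' with hz' | hz'
    · rw [List.mem_reverse] at hz'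
      exact hul (hsl hz')
    rcases List.mem_append.1 hz' with hz' | hz'
    · exact huv (List.mem_singleton.1 hz')
    · exact hul (hsl hz'))
  have t4 := s1.append t3 h1.symm (by
    intro z hz hz'
    rcases List.mem_append.1 hz' with hz' | hz'
    · obtain rfl := List.mem_singleton.1 hz'
      exact hul (hsl hz)
    rcases List.mem_append.1 hz' with hz' | hz'
    · rw [List.mem_reverse] at hz'
      exact slice_disjoint h.nodup (by omega) z hz hz'
    rcases List.mem_append.1 hz' with hz' | hz'
    · obtain rfl := List.mem_singleton.1 hz'
      exact hvl (hsl hz)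
    · exact slice_disjoint h.nodup (by omega) z hz hz')
  refine ⟨_, t4, ?_⟩
  simp only [List.length_append, List.length_reverse, List.length_singleton]
  rw [length_slice (by omega), length_slice (by omega), length_slice (by omega)]
  omega

/-- Two crossing chords shorten a path. -/
theorem shorten (h : IsPathList G W a b l) {i' j' : ℕ} {x' y' : V} (hi : l[i]? = some x)
    (hi' : l[i']? = some x') (hj : l[j]? = some y) (hj' : l[j']? = some y') (hii : i < i')
    (hij : i' ≤ j) (hjj : j < j') (h1 : G.Adj x y) (h2 : G.Adj x' y') :
    ∃ l', IsPathList G W a b l' ∧ l'.length + (i' - i - 1) + (j' - j - 1) = l.length := by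
  have hjl := lt_length_of_getElem?_eq hj'
  have s1 := h.slice h.getElem?_zero hi (Nat.zero_le i)
  have s2 := (h.slice hi' hj hij).reverse
  have s3 := h.slice hj' h.getElem?_last (by omega)
  have t2 := s2.append s3 h2 (by
    intro z hz hz'
    rw [List.mem_reverse] at hz
    exact slice_disjoint h.nodup (by omega) z hz hz')
  have t4 := s1.append t2 h1 (by
    intro z hz hz'
    rcases List.mem_append.1 hz' with hz' | hz'
    · rw [List.mem_reverse] at hz'
      exact slice_disjoint h.nodup (by omega) z hz hz'
    · exact slice_disjoint h.nodup (by omega) z hz hz')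
  refine ⟨_, t4, ?_⟩
  simp only [List.length_append, List.length_reverse]
  rw [length_slice (by omega), length_slice (by omega), length_slice (by omega)]
  omega

theorem exists_walk (h : IsPathList G W a b l) :
    ∃ w : G.Walk a b, w.IsPath ∧ w.support = l := by
  have e1 : l.head h.ne_nil = a := by
    have := h.head
    rw [List.head?_eq_some_head h.ne_nil] at this
    simpa using this
  have e2 : l.getLast h.ne_nil = b := by
    have := h.last
    rw [List.getLast?_eq_some_getLast h.ne_nil] at this
    simpa using this
  have hs := Walk.support_ofSupport (G := G) h.ne_nil h.chain
  refine ⟨(Walk.ofSupport l h.ne_nil h.chain).copy e1 e2, ?_, by simp⟩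
  rw [Walk.isPath_copy, Walk.isPath_def, hs]
  exact h.nodup

theorem hasCycleLength (h : IsPathList G W a b l) (h3 : 3 ≤ l.length) (hba : G.Adj b a) :
    HasCycleLength G l.length := by
  obtain ⟨w, hw, hs⟩ := h.exists_walk
  have hl : w.length + 1 = l.length := by rw [← hs, Walk.length_support]
  refine ⟨b, Walk.cons hba w, ?_, by simpa using hl⟩
  rw [Walk.cons_isCycle_iff]
  refine ⟨hw, fun he => ?_⟩
  have := hw.length_eq_one_of_mem_edges (Sym2.eq_swap (a := b) ▸ he)
  omega

end IsPathList

theorem exists_isPathList_of_walk {a b : (W : Set V)} (w : (G.induce (W : Set V)).Walk a b) :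
    ∃ l, IsPathList G W a b l ∧ l.length ≤ w.length + 1 := by
  classical
  refine ⟨w.bypass.support.map Subtype.val, ⟨?_, ?_, ?_, ?_, ?_⟩, ?_⟩
  · rw [List.isChain_map]
    exact w.bypass.isChain_adj_support.imp fun _ _ e => e
  · exact (w.bypass_isPath.support_nodup).map Subtype.val_injective
  · intro x hx
    obtain ⟨y, -, rfl⟩ := List.mem_map.1 hx
    exact y.2
  · rw [List.head?_map, List.head?_eq_some_head (Walk.support_ne_nil _), Walk.head_support]
    rfl
  · rw [List.getLast?_map, List.getLast?_eq_some_getLast (Walk.support_ne_nil _),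
      Walk.getLast_support]
    rfl
  · have := w.length_bypass_le_length
    simp only [List.length_map, Walk.length_support]
    omega

end PathLists

section Robust

variable {V : Type*} [Fintype V] [DecidableEq V] {G : SimpleGraph V} {W U X Y : Finset V}
  {a b c h h' u u' v v' x y z : V} {l C P : List V} {i j k n : ℕ}

/-- The neighbours of `v`, as a finset. -/
noncomputable def nbr (G : SimpleGraph V) (v : V) : Finset V := by
  classical exact Finset.univ.filter (G.Adj v)

@[simp]
theorem mem_nbr : x ∈ nbr G v ↔ G.Adj v x := by
  simp [nbr]

/-- Degree and connectivity conditions guaranteeing cycles of many lengths. -/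
structure Robust (G : SimpleGraph V) (n : ℕ) : Prop where
  large : 4511 ≤ n
  card_le : Fintype.card V ≤ 2 * n
  le_card : 2 * n ≤ Fintype.card V + 1
  deg : ∀ v, n ≤ 2 * (nbr G v).card + 3
  pair : ∀ u v, u ≠ v → n ≤ (nbr G u ∪ nbr G v).card + 2
  conn : ∀ A B : Finset V, Disjoint A B → 2 ≤ A.card → 2 ≤ B.card →
    (∀ x ∈ A, ∀ y ∈ B, ¬ G.Adj x y) → A.card + B.card + 200 ≤ Fintype.card V

/-- The vertices of `W` close to the edge `hu`. -/
noncomputable def edgeBall (G : SimpleGraph V) (W : Finset V) (h u : V) : Finset V :=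
  insert h (insert u ((nbr G h ∪ nbr G u) ∩ W))

theorem edgeBall_subset (hh : h ∈ W) (hu : u ∈ W) : edgeBall G W h u ⊆ W := by
  intro x hx
  simp only [edgeBall, Finset.mem_insert, Finset.mem_inter] at hx
  rcases hx with rfl | rfl | hx
  exacts [hh, hu, hx.2]

theorem left_mem_edgeBall : h ∈ edgeBall G W h u := by simp [edgeBall]

theorem inter_subset_edgeBall : (nbr G h ∪ nbr G u) ∩ W ⊆ edgeBall G W h u := by
  intro x hx
  simp only [edgeBall, Finset.mem_insert]
  exact Or.inr (Or.inr hx)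

theorem exists_walk_edgeBall (hh : h ∈ W) (hu : u ∈ W) (hhu : G.Adj h u)
    (hx : x ∈ edgeBall G W h u) :
    ∃ (hxW : x ∈ (W : Set V)) (w : (G.induce (W : Set V)).Walk ⟨h, hh⟩ ⟨x, hxW⟩),
      w.length ≤ 2 := by
  have hxW : x ∈ (W : Set V) := edgeBall_subset hh hu hx
  have e1 : (G.induce (W : Set V)).Adj ⟨h, hh⟩ ⟨u, hu⟩ := hhu
  refine ⟨hxW, ?_⟩
  simp only [edgeBall, Finset.mem_insert, Finset.mem_inter, Finset.mem_union, mem_nbr] at hx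
  rcases hx with rfl | rfl | ⟨hx | hx, -⟩
  · exact ⟨Walk.nil, by simp⟩
  · exact ⟨Walk.cons e1 Walk.nil, by simp⟩
  · have e2 : (G.induce (W : Set V)).Adj ⟨h, hh⟩ ⟨x, hxW⟩ := hx
    exact ⟨Walk.cons e2 Walk.nil, by simp⟩
  · have e2 : (G.induce (W : Set V)).Adj ⟨u, hu⟩ ⟨x, hxW⟩ := hx
    exact ⟨Walk.cons e1 (Walk.cons e2 Walk.nil), by simp⟩

theorem exists_isPathList_or_separated (hh : h ∈ W) (hu : u ∈ W) (hhu : G.Adj h u)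
    (hh' : h' ∈ W) (hu' : u' ∈ W) (hhu' : G.Adj h' u') :
    (∃ l, IsPathList G W h h' l ∧ l.length ≤ 6) ∨
      (Disjoint (edgeBall G W h u) (edgeBall G W h' u') ∧
        ∀ x ∈ edgeBall G W h u, ∀ y ∈ edgeBall G W h' u', ¬ G.Adj x y) := by
  by_contra! hcon
  obtain ⟨hno, hsep⟩ := hcon
  refine absurd hsep ?_
  push Not
  refine ⟨Finset.disjoint_left.2 fun x hx hx' => ?_, fun x hx y hy hxy => ?_⟩
  · obtain ⟨_, w, hw⟩ := exists_walk_edgeBall hh hu hhu hx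
    obtain ⟨_, w', hw'⟩ := exists_walk_edgeBall hh' hu' hhu' hx'
    obtain ⟨l, hl, hlen⟩ := exists_isPathList_of_walk (w.append w'.reverse)
    have := hno l hl
    simp only [Walk.length_append, Walk.length_reverse] at hlen
    omega
  · obtain ⟨hxW, w, hw⟩ := exists_walk_edgeBall hh hu hhu hx
    obtain ⟨hyW, w', hw'⟩ := exists_walk_edgeBall hh' hu' hhu' hy
    have e : (G.induce (W : Set V)).Adj ⟨x, hxW⟩ ⟨y, hyW⟩ := hxy
    obtain ⟨l, hl, hlen⟩ := exists_isPathList_of_walk (w.append (Walk.cons e w'.reverse))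
    have := hno l hl
    simp only [Walk.length_append, Walk.length_reverse, Walk.length_cons] at hlen
    omega

theorem card_le_card_inter_add (A W : Finset V) : A.card ≤ (A ∩ W).card + Wᶜ.card := by
  rw [← Finset.card_inter_add_card_sdiff A W]
  gcongr
  intro x hx
  simp only [Finset.mem_sdiff] at hx
  simpa using hx.2

theorem Robust.exists_adj (hG : Robust G n) (hW : Wᶜ.card ≤ 2000) (v : V) :
    ∃ u ∈ W, G.Adj v u := by
  have h1 := hG.deg v
  have h2 := hG.large
  have h3 := card_le_card_inter_add (nbr G v) W
  have h4 : 0 < (nbr G v ∩ W).card := by omega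
  obtain ⟨u, hu⟩ := Finset.card_pos.1 h4
  simp only [Finset.mem_inter, mem_nbr] at hu
  exact ⟨u, hu.2, hu.1⟩

theorem Robust.connect (hG : Robust G n) (hW : Wᶜ.card ≤ 90) (hh : h ∈ W) (hh' : h' ∈ W) :
    ∃ l, IsPathList G W h h' l ∧ l.length ≤ 6 := by
  obtain ⟨u, hu, hhu⟩ := hG.exists_adj (W := W) (by omega) h
  obtain ⟨u', hu', hhu'⟩ := hG.exists_adj (W := W) (by omega) h'
  refine (exists_isPathList_or_separated hh hu hhu hh' hu' hhu').resolve_right ?_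
  rintro ⟨hd, hs⟩
  have k1 := (card_le_card_inter_add (nbr G h ∪ nbr G u) W)
  have k2 := (card_le_card_inter_add (nbr G h' ∪ nbr G u') W)
  have k3 := Finset.card_le_card (inter_subset_edgeBall (G := G) (W := W) (h := h) (u := u))
  have k4 := Finset.card_le_card (inter_subset_edgeBall (G := G) (W := W) (h := h') (u := u'))
  have k5 := hG.pair _ _ hhu.ne
  have k6 := hG.pair _ _ hhu'.ne
  have k7 := hG.large
  have k8 := hG.card_le
  have := hG.conn _ _ hd (by omega) (by omega) hs
  omega

/-- The positions of the elements of `A` in `l`. -/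
def posn (l : List V) (A : Finset V) : Finset ℕ := (A ∩ l.toFinset).image l.idxOf

theorem mem_posn (hl : l.Nodup) {A : Finset V} : k ∈ posn l A ↔ ∃ x ∈ A, l[k]? = some x := by
  simp only [posn, Finset.mem_image, Finset.mem_inter, List.mem_toFinset]
  constructor
  · rintro ⟨x, ⟨hx, hxl⟩, rfl⟩
    exact ⟨x, hx, by simp [hxl]⟩
  · rintro ⟨x, hx, hk⟩
    have hxl := List.mem_of_getElem? hk
    exact ⟨x, ⟨hx, hxl⟩, hl.index_eq (by simp [hxl]) hk⟩

theorem card_posn (l : List V) (A : Finset V) : (posn l A).card = (A ∩ l.toFinset).card := by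
  refine Finset.card_image_of_injOn ?_
  intro x hx y hy hxy
  simp only [Finset.coe_inter, Set.mem_inter_iff, Finset.mem_coe, List.mem_toFinset] at hx hy
  exact (List.idxOf_inj hx.2).1 hxy

theorem posn_subset (hl : l.Nodup) (A : Finset V) : posn l A ⊆ Finset.range l.length := by
  intro k hk
  obtain ⟨x, -, hx⟩ := (mem_posn hl).1 hk
  exact Finset.mem_range.2 (lt_length_of_getElem?_eq hx)

theorem posn_union (l : List V) (A B : Finset V) : posn l (A ∪ B) = posn l A ∪ posn l B := by
  simp only [posn, Finset.union_inter_distrib_right, Finset.image_union]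

/-- A longest path from `a` to `b` inside `W`. -/
structure IsLongest (G : SimpleGraph V) (W : Finset V) (a b : V) (C : List V) : Prop extends
    IsPathList G W a b C where
  max : ∀ C', IsPathList G W a b C' → C'.length ≤ C.length

theorem IsPathList.length_le_card (hl : IsPathList G W a b l) : l.length ≤ W.card := by
  rw [← List.toFinset_card_of_nodup hl.nodup]
  exact Finset.card_le_card fun x hx => hl.mem x (List.mem_toFinset.1 hx)

theorem IsPathList.exists_isLongest (hl : IsPathList G W a b l) :
    ∃ C, IsLongest G W a b C ∧ l.length ≤ C.length := by
  classical
  let S : Set ℕ := {t | ∃ C, IsPathList G W a b C ∧ C.length = t}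
  have hS : BddAbove S := ⟨W.card, by rintro _ ⟨C, hC, rfl⟩; exact hC.length_le_card⟩
  obtain ⟨C, hC, hCl⟩ := Nat.sSup_mem (s := S) ⟨_, l, hl, rfl⟩ hS
  refine ⟨C, ⟨hC, fun C' hC' => ?_⟩, ?_⟩
  · rw [hCl]
    exact le_csSup hS ⟨C', hC', rfl⟩
  · rw [hCl]
    exact le_csSup hS ⟨l, hl, rfl⟩

namespace IsLongest

theorem attach_far (hC : IsLongest G W a b C) (hP : IsPathList G (W \ C.toFinset) u v P)
    (hi : C[i]? = some x) (hj : C[j]? = some y) (hij : i < j) (hxu : G.Adj u x)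
    (hvy : G.Adj v y) : i + P.length + 1 ≤ j := by
  have hP' : ∀ z ∈ P, z ∈ W ∧ z ∉ C := by
    intro z hz
    simpa using hP.mem z hz
  obtain ⟨l', h1, h2⟩ := hC.toIsPathList.splice hi hj hij (hP.mono fun z hz => (hP' z hz).1)
    (fun z hz => (hP' z hz).2) hxu.symm hvy
  have := hC.max l' h1
  have := lt_length_of_getElem?_eq hj
  omega

theorem eq_of_cross (hC : IsLongest G W a b C) (hu : u ∈ W \ C.toFinset)
    (hv : v ∈ W \ C.toFinset) (huv : u ≠ v) (hi : i ∈ posn C (nbr G u))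
    (hi' : i + 1 ∈ posn C (nbr G v)) (hj : j ∈ posn C (nbr G u))
    (hj' : j + 1 ∈ posn C (nbr G v)) : i = j := by
  have key : ∀ {i j}, i ∈ posn C (nbr G u) → i + 1 ∈ posn C (nbr G v) →
      j ∈ posn C (nbr G u) → j + 1 ∈ posn C (nbr G v) → ¬ i < j := by
    intro i j hi hi' hj hj' hij
    rw [mem_posn hC.nodup] at hi hi' hj hj'
    simp only [mem_nbr] at hi hi' hj hj'
    simp only [Finset.mem_sdiff, List.mem_toFinset] at hu hv
    obtain ⟨x, e1, hx⟩ := hi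
    obtain ⟨x', e1', hx'⟩ := hi'
    obtain ⟨y, e2, hy⟩ := hj
    obtain ⟨y', e2', hy'⟩ := hj'
    obtain ⟨l', h1, h2⟩ := hC.toIsPathList.cross hx hx' hy hy' hij hu.1 hv.1 hu.2 hv.2 huv
      e1 e2 e1' e2'
    have := hC.max l' h1
    omega
  have h1 := key hi hi' hj hj'
  have h2 := key hj hj' hi hi'
  omega

theorem card_eq (hC : IsPathList G W a b C) :
    C.length + (W \ C.toFinset).card + Wᶜ.card = Fintype.card V := by
  have h1 : C.toFinset ⊆ W := fun x hx => hC.mem x (List.mem_toFinset.1 hx)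
  have h2 := Finset.card_sdiff_add_card_eq_card h1
  rw [List.toFinset_card_of_nodup hC.nodup] at h2
  have h3 := Finset.card_compl_add_card W
  omega

theorem card_le (A W : Finset V) (C : List V) :
    A.card ≤ (posn C A).card + (A ∩ (W \ C.toFinset)).card + Wᶜ.card := by
  rw [card_posn]
  have : A ⊆ (A ∩ C.toFinset) ∪ (A ∩ (W \ C.toFinset)) ∪ Wᶜ := by
    intro x hx
    simp only [Finset.mem_union, Finset.mem_inter, Finset.mem_sdiff, Finset.mem_compl]
    tauto
  refine (Finset.card_le_card this).trans ((Finset.card_union_le _ _).trans ?_)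
  gcongr
  exact Finset.card_union_le _ _

theorem card_outside_le_of_four (hC : IsLongest G W a b C) (hG : Robust G n) (hW : Wᶜ.card ≤ 51)
    (hu : u ∈ W \ C.toFinset) (hu' : u' ∈ W \ C.toFinset) (hv : v ∈ W \ C.toFinset)
    (hv' : v' ∈ W \ C.toFinset) (huu : u ≠ u') (hvv : v ≠ v') (h1 : u ≠ v) (h2 : u ≠ v')
    (h3 : u' ≠ v) (h4 : u' ≠ v') :
    (W \ C.toFinset).card ≤ ((nbr G u ∪ nbr G u') ∩ (W \ C.toFinset)).card +
      ((nbr G v ∪ nbr G v') ∩ (W \ C.toFinset)).card + 60 := by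
  have c1 := card_le (nbr G u ∪ nbr G u') W C
  have c2 := card_le (nbr G v ∪ nbr G v') W C
  have c3 := card_eq hC.toIsPathList
  have c4 := hG.card_le
  have c5 := hG.pair _ _ huu
  have c6 := hG.pair _ _ hvv
  have c7 : (posn C (nbr G u ∪ nbr G u')).card + (posn C (nbr G v ∪ nbr G v')).card
      ≤ C.length + 5 := by
    set P := posn C (nbr G u ∪ nbr G u') with hP
    set Q := posn C (nbr G v ∪ nbr G v') with hQ
    have d0 : (P.image (· + 1)).card = P.card :=
      Finset.card_image_of_injective _ (add_left_injective 1)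
    have one : ∀ s ∈ W \ C.toFinset, ∀ t ∈ W \ C.toFinset, s ≠ t →
        ((posn C (nbr G s)).image (· + 1) ∩ posn C (nbr G t)).card ≤ 1 := by
      intro s hs t ht hst
      rw [Finset.card_le_one]
      intro i hi j hj
      simp only [Finset.mem_inter, Finset.mem_image] at hi hj
      obtain ⟨⟨i, hi, rfl⟩, hi'⟩ := hi
      obtain ⟨⟨j, hj, rfl⟩, hj'⟩ := hj
      rw [hC.eq_of_cross hs ht hst hi hi' hj hj']
    have d1 : (P.image (· + 1) ∩ Q).card ≤ 4 := by
      rw [hP, hQ, posn_union, posn_union, Finset.image_union, Finset.union_inter_distrib_right,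
        Finset.inter_union_distrib_left, Finset.inter_union_distrib_left]
      refine (Finset.card_union_le _ _).trans ?_
      have e1 := one u hu v hv h1
      have e2 := one u hu v' hv' h2
      have e3 := one u' hu' v hv h3
      have e4 := one u' hu' v' hv' h4
      have f1 := Finset.card_union_le ((posn C (nbr G u)).image (· + 1) ∩ posn C (nbr G v))
        ((posn C (nbr G u)).image (· + 1) ∩ posn C (nbr G v'))
      have f2 := Finset.card_union_le ((posn C (nbr G u')).image (· + 1) ∩ posn C (nbr G v))
        ((posn C (nbr G u')).image (· + 1) ∩ posn C (nbr G v'))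
      omega
    have d2 : (P.image (· + 1) ∪ Q).card ≤ C.length + 1 := by
      rw [← Finset.card_range (C.length + 1)]
      refine Finset.card_le_card (Finset.union_subset ?_ ?_)
      · intro k hk
        obtain ⟨j, hj, rfl⟩ := Finset.mem_image.1 hk
        have := Finset.mem_range.1 (posn_subset hC.nodup _ hj)
        simpa using this
      · intro k hk
        have := Finset.mem_range.1 (posn_subset hC.nodup _ hk)
        simp only [Finset.mem_range]
        omega
    have d3 := Finset.card_union_add_card_inter (P.image (· + 1)) Q
    omega
  omega

theorem le_card_outside_of_three_linked (hC : IsLongest G W a b C) (hG : Robust G n)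
    (hW : Wᶜ.card ≤ 51)
    {s : Fin 3 → V} (hs : Function.Injective s)
    (hlink : ∀ i j, ∃ P, IsPathList G (W \ C.toFinset) (s i) (s j) P) :
    n + (W \ C.toFinset).card ≤ ((nbr G (s 0) ∪ nbr G (s 1)) ∩ (W \ C.toFinset)).card +
      ((nbr G (s 0) ∪ nbr G (s 2)) ∩ (W \ C.toFinset)).card +
      ((nbr G (s 1) ∪ nbr G (s 2)) ∩ (W \ C.toFinset)).card + 110 := by
  have c1 := card_le (nbr G (s 0) ∪ nbr G (s 1)) W C
  have c2 := card_le (nbr G (s 0) ∪ nbr G (s 2)) W C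
  have c2' := card_le (nbr G (s 1) ∪ nbr G (s 2)) W C
  have c3 := card_eq hC.toIsPathList
  have c4 := hG.card_le
  have c5 := hG.pair _ _ (hs.ne (show (0 : Fin 3) ≠ 1 by decide))
  have c6 := hG.pair _ _ (hs.ne (show (0 : Fin 3) ≠ 2 by decide))
  have c6' := hG.pair _ _ (hs.ne (show (1 : Fin 3) ≠ 2 by decide))
  rw [posn_union] at c1
  rw [posn_union] at c2
  rw [posn_union] at c2'
  have one : ∀ α β i, i ∈ posn C (nbr G (s α)) → i + 1 ∉ posn C (nbr G (s β)) := by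
    intro α β i hi hj
    rw [mem_posn hC.nodup] at hi hj
    obtain ⟨P, hP⟩ := hlink α β
    obtain ⟨x, hx, hi⟩ := hi
    obtain ⟨y, hy, hj⟩ := hj
    have := hC.attach_far hP hi hj (by omega) (mem_nbr.1 hx) (mem_nbr.1 hy)
    have := hP.length_pos
    omega
  have two : ∀ α β, α ≠ β → ∀ i, i ∈ posn C (nbr G (s α)) → i + 2 ∉ posn C (nbr G (s β)) := by
    intro α β hαβ i hi hj
    rw [mem_posn hC.nodup] at hi hj
    obtain ⟨P, hP⟩ := hlink α β
    obtain ⟨x, hx, hi⟩ := hi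
    obtain ⟨y, hy, hj⟩ := hj
    have h1 := hC.attach_far hP hi hj (by omega) (mem_nbr.1 hx) (mem_nbr.1 hy)
    have h2 := hP.length_pos
    have h3 : P.length = 1 := by omega
    have h4 := hP.getElem?_zero
    have h5 := hP.getElem?_last
    rw [h3] at h5
    exact hs.ne hαβ (Option.some.inj (h4.symm.trans h5))
  set P0 := posn C (nbr G (s 0)) with hP0
  set P1 := posn C (nbr G (s 1)) with hP1
  set P2 := posn C (nbr G (s 2)) with hP2
  have key : (P0 ∪ P1).card + (P0 ∪ P2).card + (P1 ∪ P2).card ≤ C.length + 2 := by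
    set Z := P0 ∪ P1 ∪ P2 with hZ
    set Z2 := (P0 ∩ P1) ∪ (P0 ∩ P2) ∪ (P1 ∩ P2) with hZ2
    have e1 := Finset.card_union_add_card_inter (P0 ∪ P1) (P0 ∪ P2)
    have e2 := Finset.card_union_add_card_inter ((P0 ∪ P1) ∩ (P0 ∪ P2)) (P1 ∪ P2)
    have e3 : (P0 ∪ P1) ∪ (P0 ∪ P2) = Z := by ext; simp [hZ]; tauto
    have e4 : ((P0 ∪ P1) ∩ (P0 ∪ P2)) ∪ (P1 ∪ P2) = Z := by ext; simp [hZ]; tauto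
    have e5 : ((P0 ∪ P1) ∩ (P0 ∪ P2)) ∩ (P1 ∪ P2) = Z2 := by ext; simp [hZ2]; tauto
    rw [e3] at e1
    rw [e4, e5] at e2
    have hZm : ∀ {k}, k ∈ Z → ∃ α, k ∈ posn C (nbr G (s α)) := by
      intro k hk
      simp only [hZ, Finset.mem_union] at hk
      rcases hk with (hk | hk) | hk
      exacts [⟨0, hk⟩, ⟨1, hk⟩, ⟨2, hk⟩]
    have hZ2m : ∀ {k}, k ∈ Z2 → ∃ α β, α ≠ β ∧ k ∈ posn C (nbr G (s α)) ∧
        k ∈ posn C (nbr G (s β)) := by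
      intro k hk
      simp only [hZ2, Finset.mem_union, Finset.mem_inter] at hk
      rcases hk with (hk | hk) | hk
      exacts [⟨0, 1, by decide, hk⟩, ⟨0, 2, by decide, hk⟩, ⟨1, 2, by decide, hk⟩]
    have d1 : Disjoint Z (Z.image (· + 1)) := by
      rw [Finset.disjoint_left]
      intro k hk hk'
      obtain ⟨j, hj, rfl⟩ := Finset.mem_image.1 hk'
      obtain ⟨α, hα⟩ := hZm hk
      obtain ⟨β, hβ⟩ := hZm hj
      exact one β α j hβ hα
    have d2 : Disjoint (Z ∪ Z.image (· + 1)) (Z2.image (· + 2)) := by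
      rw [Finset.disjoint_left]
      intro k hk hk'
      obtain ⟨j, hj, rfl⟩ := Finset.mem_image.1 hk'
      obtain ⟨α, β, hαβ, hα, hβ⟩ := hZ2m hj
      rcases Finset.mem_union.1 hk with hk | hk
      · obtain ⟨γ, hγ⟩ := hZm hk
        by_cases hc : α = γ
        · exact two β γ (hc ▸ hαβ.symm) j hβ hγ
        · exact two α γ hc j hα hγ
      · obtain ⟨j', hj', he⟩ := Finset.mem_image.1 hk
        obtain rfl : j' = j + 1 := by simpa using he
        obtain ⟨γ, hγ⟩ := hZm hj'
        exact one α γ j hα hγ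
    have d3 : (Z ∪ Z.image (· + 1)) ∪ Z2.image (· + 2) ⊆ Finset.range (C.length + 2) := by
      have hr : ∀ α k, k ∈ posn C (nbr G (s α)) → k < C.length := fun α k hk =>
        Finset.mem_range.1 (posn_subset hC.nodup _ hk)
      intro k hk
      rw [Finset.mem_range]
      simp only [Finset.mem_union (s := Z ∪ Z.image (· + 1)), Finset.mem_union (s := Z),
        Finset.mem_image] at hk
      rcases hk with (hk | ⟨k, hk, rfl⟩) | ⟨k, hk, rfl⟩
      · obtain ⟨α, hα⟩ := hZm hk
        have := hr α k hα
        omega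
      · obtain ⟨α, hα⟩ := hZm hk
        have := hr α k hα
        omega
      · obtain ⟨α, -, -, hα, -⟩ := hZ2m hk
        have := hr α k hα
        omega
    have d4 := Finset.card_le_card d3
    rw [Finset.card_union_of_disjoint d2, Finset.card_union_of_disjoint d1, Finset.card_range,
      Finset.card_image_of_injective _ (add_left_injective 1),
      Finset.card_image_of_injective _ (add_left_injective 2)] at d4
    omega
  omega

end IsLongest

end Robust

section LongestCover

variable {V : Type*} [Fintype V] [DecidableEq V] {G : SimpleGraph V} {W U S T B F : Finset V}
  {a b c g h h' u v w x y z : V} {l C : List V} {i j k n t : ℕ}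

theorem Finset.exists_injective_fin (hk : k ≤ T.card) :
    ∃ s : Fin k → V, Function.Injective s ∧ ∀ i, s i ∈ T := by
  refine ⟨fun i => (T.equivFin.symm (Fin.castLE hk i) : V), ?_, fun i => Subtype.coe_prop _⟩
  intro i j hij
  have h1 := T.equivFin.symm.injective (Subtype.val_injective hij)
  exact Fin.castLE_injective hk h1

/-- `u` and `v` lie in the same component of the subgraph induced on `U`. -/
def Linked (G : SimpleGraph V) (U : Finset V) (u v : V) : Prop :=
  ∃ (hu : u ∈ (U : Set V)) (hv : v ∈ (U : Set V)),
    (G.induce (U : Set V)).Reachable ⟨u, hu⟩ ⟨v, hv⟩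

namespace Linked

theorem refl (hu : u ∈ U) : Linked G U u u := ⟨hu, hu, Reachable.refl _⟩

theorem symm (h : Linked G U u v) : Linked G U v u := by
  obtain ⟨hu, hv, h⟩ := h
  exact ⟨hv, hu, h.symm⟩

theorem trans (h : Linked G U u v) (h' : Linked G U v w) : Linked G U u w := by
  obtain ⟨hu, hv, h⟩ := h
  obtain ⟨hv, hw, h'⟩ := h'
  exact ⟨hu, hw, h.trans h'⟩

theorem of_adj (hu : u ∈ U) (hv : v ∈ U) (huv : G.Adj u v) : Linked G U u v := by
  have e : (G.induce (U : Set V)).Adj ⟨u, hu⟩ ⟨v, hv⟩ := huv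
  exact ⟨hu, hv, e.reachable⟩

theorem exists_isPathList (h : Linked G U u v) : ∃ l, IsPathList G U u v l := by
  obtain ⟨hu, hv, ⟨w⟩⟩ := h
  obtain ⟨l, hl, -⟩ := exists_isPathList_of_walk w
  exact ⟨l, hl⟩

end Linked

theorem linked_of_mem_edgeBall (hUW : W ⊆ U) (hh : h ∈ W) (hu : u ∈ W) (hhu : G.Adj h u)
    (hx : x ∈ edgeBall G W h u) : Linked G U h x := by
  have hxW := edgeBall_subset hh hu hx
  have e := Linked.of_adj (hUW hh) (hUW hu) hhu
  simp only [edgeBall, Finset.mem_insert, Finset.mem_inter, Finset.mem_union, mem_nbr] at hx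
  rcases hx with rfl | rfl | ⟨hx | hx, -⟩
  · exact Linked.refl (hUW hh)
  · exact e
  · exact Linked.of_adj (hUW hh) (hUW hxW) hx
  · exact e.trans (Linked.of_adj (hUW hu) (hUW hxW) hx)

theorem exists_isPathList_length (hS : ∀ v ∈ S, k ≤ (nbr G v ∩ S).card) (ha : a ∈ S)
    (ht : t ≤ k) : ∃ b l, IsPathList G S a b l ∧ l.length = t + 1 := by
  induction t with
  | zero => exact ⟨a, [a], IsPathList.singleton G ha, rfl⟩
  | succ t ih =>
    obtain ⟨b, l, hl, hlt⟩ := ih (by omega)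
    have h1 := hS b (hl.mem b hl.last_mem)
    have h2 : (l.toFinset.erase b).card = t := by
      rw [Finset.card_erase_of_mem (List.mem_toFinset.2 hl.last_mem),
        List.toFinset_card_of_nodup hl.nodup, hlt, Nat.add_sub_cancel]
    obtain ⟨c, hc, hcl⟩ := Finset.exists_mem_notMem_of_card_lt_card
      (show (l.toFinset.erase b).card < (nbr G b ∩ S).card by omega)
    simp only [Finset.mem_inter, mem_nbr] at hc
    refine ⟨c, l ++ [c], hl.append (IsPathList.singleton G hc.2) hc.1 ?_, by simp [hlt]⟩
    intro x hx hx'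
    obtain rfl := List.mem_singleton.1 hx'
    exact hcl (Finset.mem_erase.2 ⟨hc.1.ne', List.mem_toFinset.2 hx⟩)

namespace IsLongest

theorem le_three_mul_card (hC : IsLongest G W a b C) (hG : Robust G n) (hW : Wᶜ.card ≤ 51)
    (hT : 3 ≤ T.card) (hg : ∀ x ∈ T, Linked G (W \ C.toFinset) g x)
    (hB : ∀ x ∈ T, ∀ y ∈ W \ C.toFinset, G.Adj x y → y ∈ B) :
    n + (W \ C.toFinset).card ≤ 3 * B.card + 110 := by
  obtain ⟨s, hs, hsT⟩ := Finset.exists_injective_fin hT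
  have h1 := hC.le_card_outside_of_three_linked hG hW hs fun i j =>
    ((hg _ (hsT i)).symm.trans (hg _ (hsT j))).exists_isPathList
  have h2 : ∀ i j, ((nbr G (s i) ∪ nbr G (s j)) ∩ (W \ C.toFinset)).card ≤ B.card := by
    intro i j
    refine Finset.card_le_card fun x hx => ?_
    rw [Finset.mem_inter, Finset.mem_union, mem_nbr, mem_nbr] at hx
    rcases hx with ⟨hx | hx, hxU⟩
    exacts [hB _ (hsT i) x hxU hx, hB _ (hsT j) x hxU hx]
  have := h2 0 1
  have := h2 0 2
  have := h2 1 2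
  omega

/-- The vertices outside a longest path with large degree outside of it. -/
noncomputable def good (G : SimpleGraph V) (U : Finset V) : Finset V :=
  U.filter fun v => U.card ≤ 4 * (nbr G v ∩ U).card + 60

theorem card_le_card_good (hC : IsLongest G W a b C) (hG : Robust G n) (hW : Wᶜ.card ≤ 51) :
    (W \ C.toFinset).card ≤ (good G (W \ C.toFinset)).card + 3 := by
  by_contra! hcon
  have h0 : good G (W \ C.toFinset) ⊆ W \ C.toFinset := Finset.filter_subset _ _
  have h1 := Finset.card_sdiff_add_card_eq_card h0
  obtain ⟨s, hs, hsT⟩ := Finset.exists_injective_fin (k := 4)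
    (T := (W \ C.toFinset) \ good G (W \ C.toFinset)) (by omega)
  have hU : ∀ i, s i ∈ W \ C.toFinset := fun i => (Finset.mem_sdiff.1 (hsT i)).1
  have hb : ∀ i, 4 * (nbr G (s i) ∩ (W \ C.toFinset)).card + 60 < (W \ C.toFinset).card := by
    intro i
    have := (Finset.mem_sdiff.1 (hsT i)).2
    simp only [good, Finset.mem_filter, not_and, not_le] at this
    exact this (hU i)
  have key := hC.card_outside_le_of_four hG hW (hU 0) (hU 1) (hU 2) (hU 3)
    (hs.ne (by decide)) (hs.ne (by decide))
    (hs.ne (by decide)) (hs.ne (by decide)) (hs.ne (by decide)) (hs.ne (by decide))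
  rw [Finset.union_inter_distrib_right, Finset.union_inter_distrib_right] at key
  have k1 := Finset.card_union_le (nbr G (s 0) ∩ (W \ C.toFinset))
    (nbr G (s 1) ∩ (W \ C.toFinset))
  have k2 := Finset.card_union_le (nbr G (s 2) ∩ (W \ C.toFinset))
    (nbr G (s 3) ∩ (W \ C.toFinset))
  have := hb 0
  have := hb 1
  have := hb 2
  have := hb 3
  omega

/-- Either a longest path misses few vertices, or good vertices are linked to each other. -/
theorem linked_good (hC : IsLongest G W a b C) (hG : Robust G n) (hW : Wᶜ.card ≤ 51)
    (hlen : 1000 ≤ C.length) (hd : 200 ≤ (W \ C.toFinset).card) :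
    n ≤ 2 * (W \ C.toFinset).card + 110 ∧ ∀ g ∈ good G (W \ C.toFinset),
      ∀ g' ∈ good G (W \ C.toFinset), Linked G (W \ C.toFinset) g g' := by
  classical
  have hgood := hC.card_le_card_good hG hW
  have hcard := card_eq hC.toIsPathList
  have hV := hG.card_le
  set U := W \ C.toFinset with hU
  have hTl : ∀ g ∈ U, ∀ x ∈ insert g (nbr G g ∩ U), Linked G U g x := by
    intro g hg x hx
    simp only [Finset.mem_insert, Finset.mem_inter, mem_nbr] at hx
    rcases hx with rfl | ⟨hx, hxU⟩
    exacts [Linked.refl hg, Linked.of_adj hg hxU hx]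
  have hTc : ∀ g ∈ good G U, 3 ≤ (insert g (nbr G g ∩ U)).card := by
    intro g hg
    have h1 := (Finset.mem_filter.1 hg).2
    have h2 := Finset.card_le_card (Finset.subset_insert g (nbr G g ∩ U))
    omega
  have hmem : ∀ g ∈ good G U, g ∈ U := fun g hg => (Finset.mem_filter.1 hg).1
  have hlt : ∀ g ∈ U, ∀ x ∈ insert g (nbr G g ∩ U), x ∈ U := by
    intro g hg x hx
    simp only [Finset.mem_insert, Finset.mem_inter, mem_nbr] at hx
    rcases hx with rfl | ⟨hx, hxU⟩
    exacts [hg, hxU]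
  obtain ⟨g0, hg0⟩ := Finset.card_pos.1 (show 0 < (good G U).card by omega)
  have first := hC.le_three_mul_card (B := U) hG hW (hTc g0 hg0) (hTl g0 (hmem g0 hg0))
    fun x _ y hy _ => hy
  rw [← hU] at first
  refine ⟨by omega, ?_⟩
  set H := U.filter (Linked G U g0) with hH
  have second := hC.le_three_mul_card (B := H) hG hW (hTc g0 hg0) (hTl g0 (hmem g0 hg0)) (by
    intro x hx y hy hxy
    refine Finset.mem_filter.2 ⟨hy, ?_⟩
    exact (hTl g0 (hmem g0 hg0) x hx).trans
      (Linked.of_adj (hlt g0 (hmem g0 hg0) x hx) hy hxy))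
  rw [← hU] at second
  have all : ∀ g ∈ good G U, Linked G U g0 g := by
    intro g hg
    by_contra hno
    have third := hC.le_three_mul_card (B := U \ H) hG hW (hTc g hg) (hTl g (hmem g hg)) (by
      intro x hx y hy hxy
      refine Finset.mem_sdiff.2 ⟨hy, fun hyH => hno ?_⟩
      have e1 := (Finset.mem_filter.1 hyH).2
      have e2 := (hTl g (hmem g hg) x hx).trans (Linked.of_adj (hlt g (hmem g hg) x hx) hy hxy)
      exact e1.trans e2.symm)
    have hc := Finset.card_sdiff_add_card_eq_card (Finset.filter_subset (Linked G U g0) U)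
    rw [← hH] at hc
    rw [← hU] at third
    omega
  exact fun g hg g' hg' => (all g hg).symm.trans (all g' hg')

theorem connect_good (hC : IsLongest G W a b C) (hG : Robust G n) (hW : Wᶜ.card ≤ 51)
    (hlen : 1000 ≤ C.length) (hd : 200 ≤ (W \ C.toFinset).card)
    (hh : h ∈ good G (W \ C.toFinset)) (hh' : h' ∈ good G (W \ C.toFinset)) (hhF : h ∉ F)
    (hhF' : h' ∉ F) (hF : 20 * F.card ≤ C.length + 60) :
    ∃ l, IsPathList G ((W \ C.toFinset) \ F) h h' l := by
  obtain ⟨hn, -⟩ := hC.linked_good hG hW hlen hd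
  have hcard := card_eq hC.toIsPathList
  have hV := hG.card_le
  have hn' := hG.large
  set U := W \ C.toFinset with hU
  have hUF : U \ F ⊆ U := Finset.sdiff_subset
  have hsub : ∀ A : Finset V, (A ∩ U).card ≤ (A ∩ (U \ F)).card + F.card := by
    intro A
    refine (Finset.card_le_card ?_).trans (Finset.card_union_le _ _)
    intro x hx
    simp only [Finset.mem_inter, Finset.mem_union, Finset.mem_sdiff] at hx ⊢
    tauto
  have hex : ∀ g ∈ good G U, 3 ≤ (nbr G g ∩ (U \ F)).card := by
    intro g hg
    have h1 := (Finset.mem_filter.1 hg).2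
    have h2 := hsub (nbr G g)
    omega
  have hex' : ∀ g ∈ good G U, ∃ u ∈ U \ F, G.Adj g u := by
    intro g hg
    obtain ⟨u, hu⟩ := Finset.card_pos.1 (show 0 < (nbr G g ∩ (U \ F)).card by
      have := hex g hg
      omega)
    rw [Finset.mem_inter, mem_nbr] at hu
    exact ⟨u, hu.2, hu.1⟩
  have hhU : h ∈ U \ F := Finset.mem_sdiff.2 ⟨(Finset.mem_filter.1 hh).1, hhF⟩
  have hhU' : h' ∈ U \ F := Finset.mem_sdiff.2 ⟨(Finset.mem_filter.1 hh').1, hhF'⟩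
  obtain ⟨u, hu, hhu⟩ := hex' h hh
  obtain ⟨u', hu', hhu'⟩ := hex' h' hh'
  rcases exists_isPathList_or_separated hhU hu hhu hhU' hu' hhu' with ⟨l, hl, -⟩ | ⟨hdis, hsep⟩
  · exact ⟨l, hl⟩
  exfalso
  set X := edgeBall G (U \ F) h u with hX
  set Y := edgeBall G (U \ F) h' u' with hY
  have hXU : X ⊆ U := (edgeBall_subset hhU hu).trans hUF
  have hYU : Y ⊆ U := (edgeBall_subset hhU' hu').trans hUF
  have hXc : 3 ≤ X.card := (hex h hh).trans (Finset.card_le_card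
    ((Finset.inter_subset_inter_right Finset.subset_union_left).trans inter_subset_edgeBall))
  have hYc : 3 ≤ Y.card := (hex h' hh').trans (Finset.card_le_card
    ((Finset.inter_subset_inter_right Finset.subset_union_left).trans inter_subset_edgeBall))
  have t1 := hC.le_three_mul_card (B := U \ Y) hG hW hXc
    (fun x hx => linked_of_mem_edgeBall hUF hhU hu hhu hx)
    (fun x hx y hy hxy => Finset.mem_sdiff.2 ⟨hy, fun hyY => hsep x hx y hyY hxy⟩)
  have t2 := hC.le_three_mul_card (B := U \ X) hG hW hYc
    (fun x hx => linked_of_mem_edgeBall hUF hhU' hu' hhu' hx)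
    (fun x hx y hy hxy => Finset.mem_sdiff.2 ⟨hy, fun hyX => hsep y hyX x hx hxy.symm⟩)
  have c1 := Finset.card_sdiff_add_card_eq_card hYU
  have c2 := Finset.card_sdiff_add_card_eq_card hXU
  have mh : h ∈ X := left_mem_edgeBall
  have mu : u ∈ X := by simp [hX, edgeBall]
  have mh' : h' ∈ Y := left_mem_edgeBall
  have mu' : u' ∈ Y := by simp [hY, edgeBall]
  have hne : ∀ {x y}, x ∈ X → y ∈ Y → x ≠ y := fun hx hy e =>
    Finset.disjoint_left.1 hdis hx (e ▸ hy)
  have e := hC.card_outside_le_of_four hG hW (hUF hhU) (hUF hu) (hUF hhU') (hUF hu') hhu.ne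
    hhu'.ne (hne mh mh')
    (hne mh mu') (hne mu mh') (hne mu mu')
  rw [← hU] at t1 t2 e
  have s1 := hsub (nbr G h ∪ nbr G u)
  have s2 := hsub (nbr G h' ∪ nbr G u')
  have s3 := Finset.card_le_card (inter_subset_edgeBall (G := G) (W := U \ F) (h := h) (u := u))
  have s4 := Finset.card_le_card (inter_subset_edgeBall (G := G) (W := U \ F) (h := h') (u := u'))
  rw [← hX] at s3
  rw [← hY] at s4
  omega

theorem long_good (hC : IsLongest G W a b C) (hG : Robust G n) (hW : Wᶜ.card ≤ 51)
    (hlen : 1000 ≤ C.length) (hd : 200 ≤ (W \ C.toFinset).card)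
    (hh : h ∈ good G (W \ C.toFinset)) (hh' : h' ∈ good G (W \ C.toFinset)) (hne : h ≠ h') :
    ∃ l, IsPathList G (W \ C.toFinset) h h' l ∧ C.length / 20 + 2 ≤ l.length := by
  obtain ⟨hn, -⟩ := hC.linked_good hG hW hlen hd
  have hcard := card_eq hC.toIsPathList
  have hV := hG.card_le
  have hn' := hG.large
  have hgood := hC.card_le_card_good hG hW
  have hconn := fun x F => hC.connect_good (h := x) (h' := h') (F := F) hG hW hlen hd
  set U := W \ C.toFinset with hU
  set S := (good G U).erase h' with hS
  have hgU : good G U ⊆ U := Finset.filter_subset _ _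
  have hdeg : ∀ v ∈ S, C.length / 20 + 1 ≤ (nbr G v ∩ S).card := by
    intro v hv
    have h1 := (Finset.mem_filter.1 (Finset.mem_of_mem_erase hv)).2
    have h2 : (nbr G v ∩ U).card ≤ (nbr G v ∩ S).card + ((U \ good G U).card + 1) := by
      have : nbr G v ∩ U ⊆ (nbr G v ∩ S) ∪ ((U \ good G U) ∪ {h'}) := by
        intro x hx
        simp only [hS, Finset.mem_inter, Finset.mem_union, Finset.mem_sdiff, Finset.mem_erase,
          Finset.mem_singleton] at hx ⊢
        tauto
      refine (Finset.card_le_card this).trans ((Finset.card_union_le _ _).trans ?_)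
      gcongr
      exact (Finset.card_union_le _ _).trans (by simp)
    have h3 := Finset.card_sdiff_add_card_eq_card hgU
    omega
  obtain ⟨c, l, hl, hll⟩ := exists_isPathList_length hdeg (Finset.mem_erase.2 ⟨hne, hh⟩) le_rfl
  have hlS : ∀ x ∈ l, x ∈ good G U ∧ x ≠ h' := by
    intro x hx
    have := hl.mem x hx
    rw [hS, Finset.mem_erase] at this
    exact this.symm
  have hcl := hl.last_mem
  obtain ⟨p, hp⟩ := hconn c (l.toFinset.erase c) (hlS c hcl).1 hh' (by simp)
    (by simpa using fun _ hx => (hlS _ hx).2 rfl) (by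
      rw [Finset.card_erase_of_mem (by simpa using hcl), List.toFinset_card_of_nodup hl.nodup]
      omega)
  have hl1 := hl.getElem?_last
  obtain ⟨x, hx⟩ : ∃ x, l[l.length - 2]? = some x :=
    ⟨_, List.getElem?_eq_getElem (by omega)⟩
  have hs := hl.slice hl.getElem?_zero hx (Nat.zero_le _)
  have hadj := hl.adj hx (y := c) (by rw [show l.length - 2 + 1 = l.length - 1 by omega, hl1])
  have hsl : ∀ z ∈ slice l 0 (l.length - 2), z ∈ l ∧ z ≠ c := by
    intro z hz
    obtain ⟨k, -, hk, hz⟩ := mem_slice.1 hz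
    refine ⟨List.mem_of_getElem? hz, ?_⟩
    rintro rfl
    have := hl.nodup.index_eq hz hl1
    omega
  have hs' : IsPathList G U h x (slice l 0 (l.length - 2)) :=
    hs.mono fun z hz => hgU (hlS z (hsl z hz).1).1
  refine ⟨_, hs'.append (hp.mono fun z hz => (Finset.mem_sdiff.1 (hp.mem z hz)).1) hadj ?_, ?_⟩
  · intro z hz hz'
    have h1 := (Finset.mem_sdiff.1 (hp.mem z hz')).2
    have h2 := hsl z hz
    exact h1 (Finset.mem_erase.2 ⟨h2.2, List.mem_toFinset.2 h2.1⟩)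
  · have := hp.length_pos
    rw [List.length_append, length_slice (by omega)]
    omega

/-- A longest path misses few vertices. -/
theorem card_lt (hC : IsLongest G W a b C) (hG : Robust G n) (hW : Wᶜ.card ≤ 51)
    (hlen : 1000 ≤ C.length) : (W \ C.toFinset).card < 200 := by
  by_contra! hd
  have hcard := card_eq hC.toIsPathList
  have hgood := hC.card_le_card_good hG hW
  have hlong := fun h h' => hC.long_good (h := h) (h' := h') hG hW hlen hd
  set U := W \ C.toFinset with hU
  have hgU : good G U ⊆ U := Finset.filter_subset _ _
  set D := C.length / 20 + 1 with hD
  have key : ∀ h ∈ good G U, ∀ h' ∈ good G U, h ≠ h' → ∀ i j x y, C[i]? = some x →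
      C[j]? = some y → G.Adj h x → G.Adj h' y → i / D = j / D → i = j := by
    have key' : ∀ h ∈ good G U, ∀ h' ∈ good G U, h ≠ h' → ∀ i j x y, C[i]? = some x →
        C[j]? = some y → G.Adj h x → G.Adj h' y → i / D = j / D → ¬ i < j := by
      intro h hh h' hh' hne i j x y hi hj hx hy hij hlt
      obtain ⟨P, hP, hPl⟩ := hlong h h' hh hh' hne
      have h1 := hC.attach_far hP hi hj hlt hx hy
      have h2 := Nat.div_add_mod i D
      have h3 := Nat.div_add_mod j D
      have h4 := Nat.mod_lt i (show 0 < D by omega)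
      have h5 := Nat.mod_lt j (show 0 < D by omega)
      rw [hij] at h2
      omega
    intro h hh h' hh' hne i j x y hi hj hx hy hij
    have h1 := key' h hh h' hh' hne i j x y hi hj hx hy hij
    have h2 := key' h' hh' h hh hne.symm j i y x hj hi hy hx hij.symm
    omega
  have cover : ∀ t : ℕ, ∃ c : V, ∀ h ∈ good G U, ∀ k x, C[k]? = some x → k / D = t →
      G.Adj h x → h = c ∨ x = c := by
    intro t
    by_cases h0 : ∃ h0 ∈ good G U, ∃ k0 x0, C[k0]? = some x0 ∧ k0 / D = t ∧ G.Adj h0 x0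
    · obtain ⟨h0, hh0, k0, x0, hk0, ht0, ha0⟩ := h0
      by_cases h1 : ∃ h1 ∈ good G U, h1 ≠ h0 ∧ ∃ k1 x1, C[k1]? = some x1 ∧ k1 / D = t ∧
          G.Adj h1 x1
      · obtain ⟨h1, hh1, hne, k1, x1, hk1, ht1, ha1⟩ := h1
        refine ⟨x0, fun h hh k x hk ht ha => Or.inr ?_⟩
        have e1 : k1 = k0 := key h1 hh1 h0 hh0 hne k1 k0 x1 x0 hk1 hk0 ha1 ha0 (ht1.trans ht0.symm)
        have e2 : k = k0 := by
          by_cases hhh : h = h0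
          · subst hhh
            rw [← e1]
            exact key h hh h1 hh1 hne.symm k k1 x x1 hk hk1 ha ha1 (ht.trans ht1.symm)
          · exact key h hh h0 hh0 hhh k k0 x x0 hk hk0 ha ha0 (ht.trans ht0.symm)
        rw [e2, hk0] at hk
        exact (Option.some.inj hk).symm
      · push Not at h1
        refine ⟨h0, fun h hh k x hk ht ha => Or.inl ?_⟩
        by_contra hne
        exact h1 h hh hne k x hk ht ha
    · push Not at h0
      exact ⟨a, fun h hh k x hk ht ha => absurd ha (h0 h hh k x hk ht)⟩
  choose c hc using cover
  set S := (Finset.range 20).image c with hS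
  have hSc : S.card ≤ 20 := by
    simpa using Finset.card_image_le (s := Finset.range 20) (f := c)
  have h1 : (good G U).card ≤ (good G U \ S).card + S.card := by
    have := Finset.le_card_sdiff S (good G U)
    omega
  have h2 : C.length ≤ (C.toFinset \ S).card + S.card := by
    have := Finset.le_card_sdiff S C.toFinset
    rw [List.toFinset_card_of_nodup hC.nodup] at this
    omega
  have hdis : Disjoint (good G U \ S) (C.toFinset \ S) := by
    rw [Finset.disjoint_left]
    intro x hx hx'
    have e1 := hgU (Finset.mem_sdiff.1 hx).1
    exact (Finset.mem_sdiff.1 e1).2 (Finset.mem_sdiff.1 hx').1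
  have := hG.conn _ _ hdis (by omega) (by omega) (by
    intro h hh x hx hhx
    simp only [Finset.mem_sdiff, List.mem_toFinset] at hh hx
    obtain ⟨k, hk⟩ := List.mem_iff_getElem?.1 hx.1
    have hkl := lt_length_of_getElem?_eq hk
    have hkD : k / D < 20 := by
      rw [Nat.div_lt_iff_lt_mul (by omega)]
      omega
    have hmem : c (k / D) ∈ S := Finset.mem_image_of_mem _ (Finset.mem_range.2 hkD)
    rcases hc _ h hh.1 k x hk rfl hhx with e | e
    · exact hh.2 (e ▸ hmem)
    · exact hx.2 (e ▸ hmem))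
  omega

end IsLongest

end LongestCover

section Routes

variable {V : Type*} [Fintype V] [DecidableEq V] {G : SimpleGraph V} {W S : Finset V}
  {a b e s x y z : V} {l C R : List V} {i j k n t : ℕ}

/-- A path can be shortened by a small amount while keeping its ends. -/
theorem IsPathList.exists_shorter (hC : IsPathList G W a b C) (hG : Robust G n)
    (hW : Wᶜ.card ≤ 51) (h10 : 10 ≤ C.length) :
    ∃ C', IsPathList G W a b C' ∧ C'.length < C.length ∧ C.length ≤ C'.length + 11 := by
  classical
  by_contra! hno
  have hcard := IsLongest.card_eq hC
  have hV := hG.card_le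
  have hn := hG.large
  let R : ℕ → Finset V := fun I => Finset.univ.filter fun x =>
    ∃ i y, (i = 4 * I ∨ i = 4 * I + 1) ∧ C[i]? = some y ∧ G.Adj y x
  have hR : ∀ {I x}, x ∈ R I ↔ ∃ i y, (i = 4 * I ∨ i = 4 * I + 1) ∧ C[i]? = some y ∧
      G.Adj y x := by
    intro I x
    simp [R]
  have hRc : ∀ I ≤ 2, n ≤ (R I).card + 2 := by
    intro I hI
    have h0 := List.getElem?_eq_getElem (show 4 * I < C.length by omega)
    have h1 := List.getElem?_eq_getElem (show 4 * I + 1 < C.length by omega)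
    refine (hG.pair _ _ (hC.adj h0 h1).ne).trans ?_
    gcongr
    intro x hx
    rw [Finset.mem_union, mem_nbr, mem_nbr] at hx
    rcases hx with hx | hx
    exacts [hR.2 ⟨_, _, Or.inl rfl, h0, hx⟩, hR.2 ⟨_, _, Or.inr rfl, h1, hx⟩]
  have hU : ∀ I I', I < I' → I' ≤ 2 →
      Disjoint (R I ∩ (W \ C.toFinset)) (R I' ∩ (W \ C.toFinset)) := by
    intro I I' hII hI'
    rw [Finset.disjoint_left]
    intro u hu hu'
    rw [Finset.mem_inter, hR, Finset.mem_sdiff, List.mem_toFinset] at hu hu'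
    obtain ⟨⟨i, x, hi, hx, hxu⟩, huW, huC⟩ := hu
    obtain ⟨⟨j, y, hj, hy, hyu⟩, -, -⟩ := hu'
    obtain ⟨C', h1, h2⟩ := hC.splice hx hy (by omega) (IsPathList.singleton G huW)
      (by simpa using huC) hxu hyu.symm
    have := hno C' h1
    rw [List.length_singleton] at h2
    omega
  let Q : ℕ → Finset ℕ := fun I => (posn C (R I)).filter (10 ≤ ·)
  have hQ : ∀ {I j}, j ∈ Q I → 10 ≤ j ∧ j < C.length ∧
      ∃ i x y, (i = 4 * I ∨ i = 4 * I + 1) ∧ C[i]? = some x ∧ C[j]? = some y ∧ G.Adj x y := by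
    intro I j hj
    obtain ⟨hj, h10⟩ := Finset.mem_filter.1 hj
    obtain ⟨y, hy, hjy⟩ := (mem_posn hC.nodup).1 hj
    obtain ⟨i, x, hi, hx, hxy⟩ := hR.1 hy
    exact ⟨h10, lt_length_of_getElem?_eq hjy, i, x, y, hi, hx, hjy, hxy⟩
  have hQc : ∀ I ≤ 2, n ≤ (Q I).card + (R I ∩ (W \ C.toFinset)).card + Wᶜ.card + 12 := by
    intro I hI
    have h1 := hRc I hI
    have h2 := IsLongest.card_le (R I) W C
    have h3 : (posn C (R I)).card ≤ (Q I).card + 10 := by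
      have : posn C (R I) ⊆ Q I ∪ Finset.range 10 := by
        intro j hj
        rw [Finset.mem_union, Finset.mem_range, Finset.mem_filter]
        by_cases hj10 : 10 ≤ j
        exacts [Or.inl ⟨hj, hj10⟩, Or.inr (by omega)]
      refine (Finset.card_le_card this).trans ((Finset.card_union_le _ _).trans ?_)
      simp
    omega
  have hcross : ∀ I I' j j', I < I' → I' ≤ 2 → j ∈ Q I → j' ∈ Q I' → j / 5 = j' / 5 →
      ¬ j < j' := by
    intro I I' j j' hII hI' hj hj' hjj hlt
    obtain ⟨h1, h2, i, x, y, hi, hx, hy, hxy⟩ := hQ hj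
    obtain ⟨h1', h2', i', x', y', hi', hx', hy', hxy'⟩ := hQ hj'
    obtain ⟨C', h3, h4⟩ := hC.shorten hx hx' hy hy' (by omega) (by omega) hlt hxy hxy'
    have := hno C' h3
    omega
  let f : ℕ → ℕ → ℕ := fun I j => 7 * (j / 5) + (j % 5 + 2 - I)
  have hf : ∀ I ≤ 2, Function.Injective (f I) := by
    intro I hI j j' hjj
    simp only [f] at hjj
    omega
  have hfd : ∀ I I', I < I' → I' ≤ 2 → Disjoint ((Q I).image (f I)) ((Q I').image (f I')) := by
    intro I I' hII hI'
    rw [Finset.disjoint_left]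
    intro k hk hk'
    obtain ⟨j, hj, rfl⟩ := Finset.mem_image.1 hk
    obtain ⟨j', hj', hjj⟩ := Finset.mem_image.1 hk'
    simp only [f] at hjj
    have := hcross I I' j j' hII hI' hj hj' (by omega)
    omega
  have hfr : ∀ I ≤ 2, (Q I).image (f I) ⊆ Finset.range (7 * (C.length / 5 + 1)) := by
    intro I hI k hk
    obtain ⟨j, hj, rfl⟩ := Finset.mem_image.1 hk
    obtain ⟨-, h2, -⟩ := hQ hj
    simp only [f, Finset.mem_range]
    omega
  have hsum : (Q 0).card + (Q 1).card + (Q 2).card ≤ 7 * (C.length / 5 + 1) := by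
    rw [← Finset.card_range (7 * (C.length / 5 + 1)),
      ← Finset.card_image_of_injective (Q 0) (hf 0 (by omega)),
      ← Finset.card_image_of_injective (Q 1) (hf 1 (by omega)),
      ← Finset.card_image_of_injective (Q 2) (hf 2 (by omega)),
      ← Finset.card_union_of_disjoint (hfd 0 1 (by omega) (by omega)),
      ← Finset.card_union_of_disjoint]
    · exact Finset.card_le_card (Finset.union_subset
        (Finset.union_subset (hfr 0 (by omega)) (hfr 1 (by omega))) (hfr 2 (by omega)))
    · exact Finset.disjoint_union_left.2
        ⟨hfd 0 2 (by omega) (by omega), hfd 1 2 (by omega) (by omega)⟩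
  have hUsum : (R 0 ∩ (W \ C.toFinset)).card + (R 1 ∩ (W \ C.toFinset)).card +
      (R 2 ∩ (W \ C.toFinset)).card ≤ (W \ C.toFinset).card := by
    rw [← Finset.card_union_of_disjoint (hU 0 1 (by omega) (by omega)),
      ← Finset.card_union_of_disjoint]
    · exact Finset.card_le_card (Finset.union_subset (Finset.union_subset
        Finset.inter_subset_right Finset.inter_subset_right) Finset.inter_subset_right)
    · exact Finset.disjoint_union_left.2
        ⟨hU 0 2 (by omega) (by omega), hU 1 2 (by omega) (by omega)⟩
  have q0 := hQc 0 (by omega)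
  have q1 := hQc 1 (by omega)
  have q2 := hQc 2 (by omega)
  omega

theorem IsPathList.exists_length_near (hC : IsPathList G W a b C) (hG : Robust G n)
    (hW : Wᶜ.card ≤ 51) (ht : 10 ≤ t) (htC : t ≤ C.length) :
    ∃ C', IsPathList G W a b C' ∧ t ≤ C'.length ∧ C'.length ≤ t + 10 := by
  induction hk : C.length using Nat.strong_induction_on generalizing C with
  | _ k ih =>
    by_cases hle : C.length ≤ t + 10
    · exact ⟨C, hC, htC, hle⟩
    · obtain ⟨C', h1, h2, h3⟩ := hC.exists_shorter hG hW (by omega)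
      exact ih _ (by omega) h1 (by omega) rfl

/-- The part of a path before it first meets `S`. -/
theorem IsPathList.exists_prefix (hl : IsPathList G W a b l) (ha : a ∉ S) (hb : b ∈ S) :
    ∃ c r p, IsPathList G W a c p ∧ G.Adj c r ∧ r ∈ S ∧ r ∈ l ∧ (∀ x ∈ p, x ∉ S ∧ x ∈ l) ∧
      p.length ≤ l.length := by
  classical
  have hex : ∃ i r, l[i]? = some r ∧ r ∈ S := ⟨_, b, hl.getElem?_last, hb⟩
  obtain ⟨r, hr, hrS⟩ := Nat.find_spec hex
  set i := Nat.find hex with hi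
  have hil := lt_length_of_getElem?_eq hr
  have h0 : i ≠ 0 := by
    intro h0
    rw [h0, hl.getElem?_zero] at hr
    exact ha (Option.some.inj hr ▸ hrS)
  obtain ⟨c, hc⟩ : ∃ c, l[i - 1]? = some c := ⟨_, List.getElem?_eq_getElem (by omega)⟩
  refine ⟨c, r, _root_.slice l 0 (i - 1), hl.slice hl.getElem?_zero hc (Nat.zero_le _),
    hl.adj hc (by rw [Nat.sub_add_cancel (by omega), hr]), hrS, List.mem_of_getElem? hr, ?_, ?_⟩
  · intro x hx
    obtain ⟨k, -, hk, hkx⟩ := mem_slice.1 hx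
    exact ⟨fun hxS => Nat.find_min hex (show k < Nat.find hex by omega) ⟨x, hkx, hxS⟩,
      List.mem_of_getElem? hkx⟩
  · rw [length_slice (by omega)]
    omega

/-- The longer of the two arcs of a cycle. -/
theorem IsPathList.exists_arc (hR : IsPathList G W a b R) (hk : R[k]? = some z) (haz : G.Adj a z)
    (hi : R[i]? = some x) (hj : R[j]? = some y) (hij : i ≠ j) (hik : i ≤ k) (hjk : j ≤ k) :
    ∃ p, IsPathList G W x y p ∧ (∀ u ∈ p, u ∈ _root_.slice R 0 k) ∧ k ≤ 2 * p.length := by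
  have key : ∀ {i j x y}, R[i]? = some x → R[j]? = some y → i < j → j ≤ k →
      ∃ p, IsPathList G W x y p ∧ (∀ u ∈ p, u ∈ _root_.slice R 0 k) ∧ k ≤ 2 * p.length := by
    intro i j x y hi hj hij hjk
    have hkl := lt_length_of_getElem?_eq hk
    have hsub : ∀ {i j : ℕ}, j ≤ k → ∀ u ∈ _root_.slice R i j, u ∈ _root_.slice R 0 k := by
      intro i j hj u hu
      obtain ⟨m, -, h2, h3⟩ := mem_slice.1 hu
      exact mem_slice.2 ⟨m, Nat.zero_le _, by omega, h3⟩
    by_cases hlen : k ≤ 2 * (j + 1 - i)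
    · refine ⟨_, hR.slice hi hj hij.le, hsub hjk, ?_⟩
      rwa [length_slice (by omega)]
    · have s1 := (hR.slice hR.getElem?_zero hi (Nat.zero_le _)).reverse
      have s2 := (hR.slice hj hk hjk).reverse
      refine ⟨_, s1.append s2 haz ?_, ?_, ?_⟩
      · intro u hu hu'
        rw [List.mem_reverse] at hu hu'
        exact slice_disjoint hR.nodup (by omega) u hu hu'
      · intro u hu
        rw [List.mem_append, List.mem_reverse, List.mem_reverse] at hu
        rcases hu with hu | hu
        exacts [hsub (by omega) u hu, hsub le_rfl u hu]
      · rw [List.length_append, List.length_reverse, List.length_reverse,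
          length_slice (by omega), length_slice (by omega)]
        omega
  rcases Nat.lt_or_gt_of_ne hij with h | h
  · exact key hi hj h hjk
  · obtain ⟨p, h1, h2, h3⟩ := key hj hi h hik
    exact ⟨p.reverse, h1.reverse, by simpa using h2, by simpa using h3⟩

theorem Robust.exists_long_cycle (hG : Robust G n) (hW : Wᶜ.card ≤ 51) (ha : a ∈ W) :
    ∃ x y z R k, IsPathList G W x y R ∧ R[k]? = some z ∧ G.Adj x z ∧ 2000 ≤ k := by
  let T : Set ℕ := {t | ∃ x y C, IsPathList G W x y C ∧ C.length = t}
  have hT : BddAbove T := ⟨W.card, by rintro _ ⟨x, y, C, hC, rfl⟩; exact hC.length_le_card⟩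
  obtain ⟨x, y, R, hR, hRl⟩ := Nat.sSup_mem (s := T) ⟨_, a, a, _, IsPathList.singleton G ha, rfl⟩ hT
  have hmax : ∀ {x y C}, IsPathList G W x y C → C.length ≤ R.length := by
    intro x y C hC
    rw [hRl]
    exact le_csSup hT ⟨x, y, C, hC, rfl⟩
  have hsub : nbr G x ∩ (W \ R.toFinset) = ∅ := by
    rw [Finset.eq_empty_iff_forall_notMem]
    intro u hu
    rw [Finset.mem_inter, mem_nbr, Finset.mem_sdiff, List.mem_toFinset] at hu
    have := hmax ((IsPathList.singleton G hu.2.1).append hR hu.1.symm (by simpa using hu.2.2))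
    rw [List.length_append, List.length_singleton] at this
    omega
  have h1 := IsLongest.card_le (nbr G x) W R
  rw [hsub, Finset.card_empty] at h1
  have h2 := hG.deg x
  have h3 := hG.large
  obtain ⟨k, hk, hk2⟩ : ∃ k ∈ posn R (nbr G x), 2000 ≤ k := by
    by_contra! hcon
    have : posn R (nbr G x) ⊆ Finset.range 2000 := fun k hk => Finset.mem_range.2 (hcon k hk)
    have := Finset.card_le_card this
    rw [Finset.card_range] at this
    omega
  obtain ⟨z, hz, hkz⟩ := (mem_posn hR.nodup).1 hk
  exact ⟨x, y, z, R, k, hR, hkz, mem_nbr.1 hz, hk2⟩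

theorem card_compl_sdiff_le (W F : Finset V) : (W \ F)ᶜ.card ≤ Wᶜ.card + F.card := by
  refine (Finset.card_le_card ?_).trans (Finset.card_union_le _ _)
  intro x hx
  simp only [Finset.mem_compl, Finset.mem_sdiff, Finset.mem_union] at hx ⊢
  tauto

theorem Robust.exists_long_route (hG : Robust G n) (hW : Wᶜ.card ≤ 49) (he : e ∈ W) (hs : s ∈ W)
    (hes : e ≠ s) : ∃ C, IsPathList G W e s C ∧ 1000 ≤ C.length := by
  have hW' := card_compl_sdiff_le W {e, s}
  rw [Finset.card_pair hes] at hW'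
  have hne : (W \ {e, s}).Nonempty := by
    rw [← Finset.card_pos]
    have := Finset.card_add_card_compl (W \ {e, s})
    have := hG.le_card
    have := hG.large
    omega
  obtain ⟨a, ha⟩ := hne
  obtain ⟨x, y, z, R, k, hR, hk, hxz, hk2⟩ := hG.exists_long_cycle (by omega) ha
  have hkl := lt_length_of_getElem?_eq hk
  have hRW : ∀ {u}, u ∈ slice R 0 k → u ∈ W ∧ u ≠ e ∧ u ≠ s := by
    intro u hu
    obtain ⟨m, -, -, h3⟩ := mem_slice.1 hu
    have := hR.mem u (List.mem_of_getElem? h3)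
    simp only [Finset.mem_sdiff, Finset.mem_insert, Finset.mem_singleton, not_or] at this
    exact this
  have hx : x ∈ slice R 0 k := mem_slice.2 ⟨0, le_rfl, Nat.zero_le _, hR.getElem?_zero⟩
  have hz : z ∈ slice R 0 k := mem_slice.2 ⟨k, Nat.zero_le _, le_rfl, hk⟩
  obtain ⟨l1, hl1, hl1c⟩ := hG.connect (W := W \ {s}) (h := e) (h' := x)
    ((card_compl_sdiff_le W {s}).trans (by rw [Finset.card_singleton]; omega))
    (by simp [he, hes]) (by simpa using ⟨(hRW hx).1, (hRW hx).2.2⟩)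
  obtain ⟨c1, r1, p1, hp1, hcr1, hr1, -, hp1S, hp1c⟩ := hl1.exists_prefix
    (S := (slice R 0 k).toFinset) (by simpa using fun h => (hRW h).2.1 rfl) (by simpa using hx)
  simp only [List.mem_toFinset] at hr1 hp1S
  obtain ⟨z', hz', hzr⟩ : ∃ z' ∈ slice R 0 k, z' ≠ r1 := by
    by_cases hxr : x = r1
    · exact ⟨z, hz, hxr ▸ hxz.ne'⟩
    · exact ⟨x, hx, hxr⟩
  have hF : (insert r1 p1.toFinset).card ≤ 7 := by
    refine (Finset.card_insert_le _ _).trans ?_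
    have := List.toFinset_card_le p1
    omega
  have hp1s : s ∉ p1 := fun h => by simpa using hp1.mem s h
  obtain ⟨l2, hl2, hl2c⟩ := hG.connect (W := W \ (insert r1 p1.toFinset)) (h := s) (h' := z')
    ((card_compl_sdiff_le W _).trans (by omega))
    (by
      simp only [Finset.mem_sdiff, Finset.mem_insert, List.mem_toFinset, not_or]
      exact ⟨hs, (hRW hr1).2.2.symm, hp1s⟩)
    (by
      simp only [Finset.mem_sdiff, Finset.mem_insert, List.mem_toFinset, not_or]
      exact ⟨(hRW hz').1, hzr, fun h => (hp1S z' h).1 hz'⟩)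
  obtain ⟨c2, r2, p2, hp2, hcr2, hr2, hr2l, hp2S, -⟩ := hl2.exists_prefix
    (S := (slice R 0 k).toFinset) (by simpa using fun h => (hRW h).2.2 rfl) (by simpa using hz')
  simp only [List.mem_toFinset] at hr2 hp2S
  have hr2' := hl2.mem r2 hr2l
  simp only [Finset.mem_sdiff, Finset.mem_insert, List.mem_toFinset, not_or] at hr2'
  obtain ⟨i, -, hik, hi⟩ := mem_slice.1 hr1
  obtain ⟨j, -, hjk, hj⟩ := mem_slice.1 hr2
  obtain ⟨q, hq, hqS, hqk⟩ := hR.exists_arc hk hxz hi hj (by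
    rintro rfl
    exact hr2'.2.1 (Option.some.inj (hj.symm.trans hi))) hik hjk
  have hp1' : IsPathList G W e c1 p1 := hp1.mono fun u hu => (Finset.mem_sdiff.1 (hp1.mem u hu)).1
  have hp2' : IsPathList G W s c2 p2 := hp2.mono fun u hu => (Finset.mem_sdiff.1 (hp2.mem u hu)).1
  have hq' : IsPathList G W r1 r2 q := hq.mono fun u hu => (Finset.mem_sdiff.1 (hq.mem u hu)).1
  refine ⟨_, hp1'.append (hq'.append hp2'.reverse hcr2.symm ?_) hcr1 ?_, ?_⟩
  · intro u hu hu'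
    exact (hp2S u (List.mem_reverse.1 hu')).1 (hqS u hu)
  · intro u hu hu'
    rcases List.mem_append.1 hu' with hu' | hu'
    · exact (hp1S u hu).1 (hqS u hu')
    · have := hp2.mem u (List.mem_reverse.1 hu')
      simp only [Finset.mem_sdiff, Finset.mem_insert, List.mem_toFinset, not_or] at this
      exact this.2.2 hu
  · rw [List.length_append, List.length_append]
    omega

/-- Between two vertices there are paths of almost every length. -/
theorem Robust.exists_route (hG : Robust G n) (hW : Wᶜ.card ≤ 49) (he : e ∈ W) (hs : s ∈ W)
    (hes : e ≠ s) (ht : 10 ≤ t) (htn : t + 260 ≤ 2 * n) :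
    ∃ C, IsPathList G W e s C ∧ t ≤ C.length ∧ C.length ≤ t + 10 := by
  obtain ⟨C0, hC0, hC0l⟩ := hG.exists_long_route hW he hs hes
  obtain ⟨C, hC, hCl⟩ := hC0.exists_isLongest
  have h1 := hC.card_lt hG (by omega) (by omega)
  have h2 := IsLongest.card_eq hC.toIsPathList
  have h3 := hG.le_card
  exact hC.toIsPathList.exists_length_near hG (by omega) ht (by omega)

end Routes

section Gadgets

variable {V : Type*} [Fintype V] [DecidableEq V] {G : SimpleGraph V} {Q F W : Finset V}
  {a b e s u v x y z : V} {l C : List V} {i j k m n r t c J ε : ℕ}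

/-- Inside `Q` there are paths from `s` to `e` with `c + 2 j + r` vertices for all `j ≤ J` and
`r ≤ ε`. -/
def Flexible (G : SimpleGraph V) (Q : Finset V) (s e : V) (c J ε : ℕ) : Prop :=
  ∀ j ≤ J, ∀ r ≤ ε, ∃ l, IsPathList G Q s e l ∧ l.length = c + 2 * j + r

theorem exists_walk_getVert (w : G.Walk u v) (hij : i ≤ j) (hj : j ≤ w.length) :
    ∃ p : G.Walk (w.getVert i) (w.getVert j), p.length = j - i := by
  induction j, hij using Nat.le_induction with
  | base => exact ⟨Walk.nil, by simp⟩
  | succ j hij ih =>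
    obtain ⟨p, hp⟩ := ih (by omega)
    refine ⟨p.concat (w.adj_getVert_succ (by omega)), ?_⟩
    rw [Walk.length_concat, hp]
    omega

theorem walk_bound_of_minimal_odd (w : G.Walk v v) (hodd : Odd w.length)
    (hmin : ∀ u (p : G.Walk u u), Odd p.length → w.length ≤ p.length) (hij : i < j)
    (hj : j ≤ w.length) (p : G.Walk (w.getVert j) (w.getVert i)) :
    (Odd (j - i + p.length) ∧ w.length ≤ j - i + p.length) ∨
      (Even (j - i + p.length) ∧ j - i ≤ p.length) := by
  obtain ⟨q1, h1⟩ := exists_walk_getVert w (Nat.zero_le i) (by omega)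
  obtain ⟨q2, h2⟩ := exists_walk_getVert w hij.le hj
  obtain ⟨q3, h3⟩ := exists_walk_getVert w hj le_rfl
  rcases Nat.even_or_odd (j - i + p.length) with he | ho
  · refine Or.inr ⟨he, ?_⟩
    have hclose : w.getVert w.length = w.getVert 0 := by simp
    have := hmin _ (q3.append ((q1.copy hclose.symm rfl).append p.reverse)) (by
      simp only [Walk.length_append, Walk.length_copy, Walk.length_reverse]
      grind)
    simp only [Walk.length_append, Walk.length_copy, Walk.length_reverse] at this
    omega
  · refine Or.inl ⟨ho, ?_⟩
    have := hmin _ (q2.append p) (by rwa [Walk.length_append, h2])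
    rwa [Walk.length_append, h2] at this

theorem Robust.exists_flexible_odd (hG : Robust G n) (w0 : G.Walk v v) (hw0 : Odd w0.length) :
    ∃ Q s e c, Flexible G Q s e c 0 1 ∧ Q.card ≤ 11 ∧ c ≤ 6 := by
  classical
  have hex : ∃ k, ∃ v, ∃ w : G.Walk v v, Odd w.length ∧ w.length = k := ⟨_, v, w0, hw0, rfl⟩
  obtain ⟨v, w, hodd, hwl⟩ := Nat.find_spec hex
  have hmin : ∀ u (p : G.Walk u u), Odd p.length → w.length ≤ p.length := by
    intro u p hp
    rw [hwl]
    exact Nat.find_min' hex ⟨u, p, hp, rfl⟩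
  clear hwl
  have hinj : ∀ i j, i < j → j < w.length → w.getVert i ≠ w.getVert j := by
    intro i j hij hj he
    rcases walk_bound_of_minimal_odd w hodd hmin hij hj.le (Walk.nil.copy rfl he.symm) with h | h
    all_goals simp only [Walk.length_copy, Walk.length_nil] at h; omega
  have hcommon : ∀ i j x, i < j → j < w.length → G.Adj (w.getVert i) x → G.Adj (w.getVert j) x →
      j - i ≤ 2 ∨ (Odd (j - i) ∧ w.length ≤ j - i + 2) := by
    intro i j x hij hj hi hjx
    have := walk_bound_of_minimal_odd w hodd hmin hij hj.le
      (Walk.cons hjx (Walk.cons hi.symm Walk.nil))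
    simp only [Walk.length_cons, Walk.length_nil] at this
    grind
  have hle : w.length ≤ 11 := by
    by_contra! hlt
    have h13 : 13 ≤ w.length := by
      obtain ⟨k, hk⟩ := hodd
      omega
    have hd : ∀ i j, (i = 0 ∧ (j = 4 ∨ j = 8)) ∨ (i = 4 ∧ j = 8) →
        Disjoint (nbr G (w.getVert i) ∪ nbr G (w.getVert (i + 1)))
          (nbr G (w.getVert j) ∪ nbr G (w.getVert (j + 1))) := by
      intro i j hij
      have key : ∀ i' j' x, (i' = i ∨ i' = i + 1) → (j' = j ∨ j' = j + 1) →
          G.Adj (w.getVert i') x → ¬ G.Adj (w.getVert j') x := by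
        intro i' j' x hi' hj' h1 h2
        have := hcommon i' j' x (by omega) (by omega) h1 h2
        omega
      rw [Finset.disjoint_left]
      intro x hx hx'
      rw [Finset.mem_union, mem_nbr, mem_nbr] at hx hx'
      rcases hx with hx | hx <;> rcases hx' with hx' | hx'
      exacts [key i j x (by simp) (by simp) hx hx', key i (j + 1) x (by simp) (by simp) hx hx',
        key (i + 1) j x (by simp) (by simp) hx hx',
        key (i + 1) (j + 1) x (by simp) (by simp) hx hx']
    have hp : ∀ i < w.length, n ≤ (nbr G (w.getVert i) ∪ nbr G (w.getVert (i + 1))).card + 2 :=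
      fun i hi => hG.pair _ _ (w.adj_getVert_succ hi).ne
    have h0 := hp 0 (by omega)
    have h4 := hp 4 (by omega)
    have h8 := hp 8 (by omega)
    have hu := Finset.card_le_univ ((nbr G (w.getVert 0) ∪ nbr G (w.getVert (0 + 1))) ∪
      (nbr G (w.getVert 4) ∪ nbr G (w.getVert (4 + 1))) ∪
      (nbr G (w.getVert 8) ∪ nbr G (w.getVert (8 + 1))))
    rw [Finset.card_union_of_disjoint (Finset.disjoint_union_left.2
      ⟨hd 0 8 (by simp), hd 4 8 (by simp)⟩), Finset.card_union_of_disjoint (hd 0 4 (by simp))] at hu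
    have := hG.card_le
    have := hG.large
    omega
  obtain ⟨k, hk⟩ := hodd
  have hk0 : k ≠ 0 := by
    rintro rfl
    have := w.adj_getVert_succ (i := 0) (by omega)
    rw [show 0 + 1 = w.length by omega, Walk.getVert_length, Walk.getVert_zero] at this
    exact this.ne rfl
  have hget : ∀ i < 2 * k + 1, ((List.range (2 * k + 1)).map w.getVert)[i]? =
      some (w.getVert i) := by
    intro i hi
    simp [List.getElem?_range hi]
  have hL : IsPathList G ((Finset.range (2 * k + 1)).image w.getVert) (w.getVert 0)
      (w.getVert (2 * k)) ((List.range (2 * k + 1)).map w.getVert) := by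
    refine ⟨?_, ?_, ?_, ?_, ?_⟩
    · rw [List.isChain_iff_getElem]
      intro i hi
      simp only [List.length_map, List.length_range] at hi
      simpa using w.adj_getVert_succ (i := i) (by omega)
    · refine List.Nodup.map_on ?_ List.nodup_range
      intro i hi j hj hij
      rw [List.mem_range] at hi hj
      by_contra hne
      rcases Nat.lt_or_gt_of_ne hne with h | h
      exacts [hinj i j h (by omega) hij, hinj j i h (by omega) hij.symm]
    · intro x hx
      obtain ⟨i, hi, rfl⟩ := List.mem_map.1 hx
      exact Finset.mem_image_of_mem _ (by simpa using hi)
    · rw [List.head?_eq_getElem?, hget 0 (by omega)]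
    · rw [List.getLast?_eq_getElem?, List.length_map, List.length_range, hget _ (by omega)]
      rfl
  refine ⟨(Finset.range (2 * k + 1)).image w.getVert, w.getVert 0, w.getVert k, k + 1, ?_,
    Finset.card_image_le.trans (by rw [Finset.card_range]; omega), by omega⟩
  have s1 := hL.slice (hget 0 (by omega)) (hget k (by omega)) (Nat.zero_le k)
  have s2 := (hL.slice (hget k (by omega)) (hget (2 * k) (by omega)) (by omega)).reverse
  have hadj : G.Adj (w.getVert 0) (w.getVert (2 * k)) := by
    have := w.adj_getVert_succ (i := 2 * k) (by omega)
    rw [← hk, Walk.getVert_length] at this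
    rw [Walk.getVert_zero]
    exact this.symm
  have s3 := (IsPathList.singleton G (hL.mem _ hL.head_mem)).append s2 hadj (by
    intro x hx hx'
    obtain rfl := List.mem_singleton.1 hx
    rw [List.mem_reverse, mem_slice] at hx'
    obtain ⟨i, h1, h2, h3⟩ := hx'
    have := hL.nodup.index_eq h3 (hget 0 (by omega))
    omega)
  intro j hj r hr
  obtain rfl : j = 0 := by omega
  rcases Nat.le_one_iff_eq_zero_or_eq_one.1 hr with rfl | rfl
  · exact ⟨_, s1, by rw [length_slice (by simp; omega)]; omega⟩
  · refine ⟨_, s3, ?_⟩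
    rw [List.length_append, List.length_reverse, List.length_singleton,
      length_slice (by simp)]
    omega

theorem Robust.exists_fourCycle (hG : Robust G n) (hF : F.card ≤ 60) :
    ∃ v x w y, G.Adj v x ∧ G.Adj x w ∧ G.Adj w y ∧ G.Adj y v ∧ v ≠ w ∧ x ≠ y ∧
      v ∉ F ∧ x ∉ F ∧ w ∉ F ∧ y ∉ F := by
  have hn := hG.large
  have hV := hG.card_le
  have hcF := Finset.card_compl_add_card F
  have hV' := hG.le_card
  obtain ⟨v, hv⟩ := Finset.card_pos.1 (show 0 < Fᶜ.card by omega)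
  have hdeg : ∀ u (F : Finset V), F.card ≤ 61 → (n - 3) / 2 ≤ (nbr G u \ F).card + 61 := by
    intro u F hF
    have h1 := hG.deg u
    have h2 := Finset.le_card_sdiff F (nbr G u)
    omega
  have h5 := hdeg v F (by omega)
  obtain ⟨s, hs, hsT⟩ := Finset.exists_injective_fin (k := 5) (T := nbr G v \ F) (by omega)
  have hF' : (insert v F).card ≤ 61 := (Finset.card_insert_le _ _).trans (by omega)
  obtain ⟨i, j, hij, hnd⟩ : ∃ i j, i ≠ j ∧
      ¬ Disjoint (nbr G (s i) \ insert v F) (nbr G (s j) \ insert v F) := by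
    by_contra! hcon
    have h1 := Finset.card_biUnion (s := Finset.univ) (t := fun i => nbr G (s i) \ insert v F)
      (fun i _ j _ hij => hcon i j hij)
    have h2 := Finset.card_le_univ (Finset.univ.biUnion fun i => nbr G (s i) \ insert v F)
    rw [h1, Fin.sum_univ_five] at h2
    have := hdeg (s 0) _ hF'
    have := hdeg (s 1) _ hF'
    have := hdeg (s 2) _ hF'
    have := hdeg (s 3) _ hF'
    have := hdeg (s 4) _ hF'
    omega
  obtain ⟨w, hw, hw'⟩ := Finset.not_disjoint_iff.1 hnd
  simp only [Finset.mem_sdiff, mem_nbr, Finset.mem_insert, not_or, Finset.mem_compl]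
    at hw hw' hsT hv
  exact ⟨v, s i, w, s j, (hsT i).1, hw.1, hw'.1.symm, (hsT j).1.symm, fun h => hw.2.1 h.symm,
    hs.ne hij, hv, (hsT i).2, hw.2.2, (hsT j).2⟩

theorem Flexible.extend (hQ : Flexible G Q s e c J ε) (hG : Robust G n) (hQc : Q.card ≤ 43) :
    ∃ Q' e' c', Flexible G Q' s e' c' (J + 1) ε ∧ Q'.card ≤ Q.card + 8 ∧ c' ≤ c + 6 ∧
      s ≠ e' := by
  obtain ⟨l0, hl0, -⟩ := hQ 0 (Nat.zero_le _) 0 (Nat.zero_le _)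
  have hsQ : s ∈ Q := hl0.mem _ hl0.head_mem
  have heQ : e ∈ Q := hl0.mem _ hl0.last_mem
  obtain ⟨v, x, w, y, hvx, hxw, hwy, hyv, hvw, hxy, hv, hx, hw, hy⟩ :=
    hG.exists_fourCycle (F := Q) (by omega)
  have hev : e ≠ v := fun h => hv (h ▸ heQ)
  set F := Q.erase e ∪ {x, w, y} with hF
  have hFc : F.card ≤ 46 := by
    refine (Finset.card_union_le _ _).trans ?_
    have h1 := Finset.card_le_three (a := x) (b := w) (c := y)
    have h2 := Finset.card_erase_le (s := Q) (a := e)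
    omega
  obtain ⟨p, hp, hpc⟩ := hG.connect (W := Fᶜ) (h := e) (h' := v) (by rw [compl_compl]; omega)
    (by
      simp only [hF, Finset.mem_compl, Finset.mem_union, Finset.mem_erase, Finset.mem_insert,
        Finset.mem_singleton]
      rintro (h | rfl | rfl | rfl)
      exacts [h.1 rfl, hx heQ, hw heQ, hy heQ])
    (by
      simp only [hF, Finset.mem_compl, Finset.mem_union, Finset.mem_erase, Finset.mem_insert,
        Finset.mem_singleton]
      rintro (h | rfl | rfl | rfl)
      exacts [hv h.2, hvx.ne rfl, hvw rfl, hyv.ne rfl])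
  have hp0 := hp.getElem?_zero
  have hp1 := hp.getElem?_last
  have hp2 : 2 ≤ p.length := by
    have := hp.length_pos
    by_contra! hlt
    rw [show p.length - 1 = 0 by omega, hp0] at hp1
    exact hev (Option.some.inj hp1)
  obtain ⟨b, hb⟩ : ∃ b, p[1]? = some b := ⟨_, List.getElem?_eq_getElem (by omega)⟩
  have heb : G.Adj e b := hp.adj hp0 hb
  have hpf := hp.slice hb hp1 (by omega)
  set f := slice p 1 (p.length - 1) with hf
  have hfl : f.length = p.length - 1 := by
    rw [hf, length_slice (by omega)]
    omega
  have hfm : ∀ z ∈ f, z ∉ Q ∧ z ≠ x ∧ z ≠ w ∧ z ≠ y := by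
    intro z hz
    have h1 := hpf.mem z hz
    simp only [hF, Finset.mem_compl, Finset.mem_union, Finset.mem_erase, Finset.mem_insert,
      Finset.mem_singleton, not_or, not_and] at h1
    refine ⟨fun hzQ => h1.1 ?_ hzQ, h1.2⟩
    rintro rfl
    obtain ⟨k, hk, -, hkz⟩ := mem_slice.1 hz
    have := hp.nodup.index_eq hkz hp0
    omega
  set Q' := Q ∪ (f.toFinset ∪ {x, w, y}) with hQ'
  have memf : ∀ z ∈ f, z ∈ Q' := fun z hz => by simp [hQ', hz]
  have mx : x ∈ Q' := by simp [hQ']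
  have mw : w ∈ Q' := by simp [hQ']
  have my : y ∈ Q' := by simp [hQ']
  have hf' : IsPathList G Q' b v f := hpf.mono memf
  have g1 := hf'.append (IsPathList.singleton G mx) hvx (by
    intro z hz hz'
    exact (hfm z hz).2.1 (List.mem_singleton.1 hz'))
  have g2 : IsPathList G Q' b x (f ++ ([y] ++ ([w] ++ [x]))) := by
    refine hf'.append ((IsPathList.singleton G my).append ((IsPathList.singleton G mw).append
      (IsPathList.singleton G mx) hxw.symm ?_) hwy.symm ?_) hyv.symm ?_
    · simpa using hxw.ne'
    · simpa using ⟨hwy.ne', hxy.symm⟩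
    · intro z hz
      simpa using ⟨(hfm z hz).2.2.2, (hfm z hz).2.2.1, (hfm z hz).2.1⟩
  have join : ∀ {l g}, IsPathList G Q s e l → IsPathList G Q' b x g → (∀ z ∈ g, z ∉ Q) →
      IsPathList G Q' s x (l ++ g) := by
    intro l g hl hg hgQ
    exact (hl.mono fun z hz => Finset.mem_union_left _ (hl.mem z hz)).append hg heb
      fun z hz hz' => hgQ z hz' (hl.mem z hz)
  have hg1 : ∀ z ∈ f ++ [x], z ∉ Q := by
    intro z hz
    rw [List.mem_append, List.mem_singleton] at hz
    rcases hz with hz | rfl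
    exacts [(hfm z hz).1, hx]
  have hg2 : ∀ z ∈ f ++ ([y] ++ ([w] ++ [x])), z ∉ Q := by
    intro z hz
    simp only [List.mem_append, List.mem_singleton] at hz
    rcases hz with hz | rfl | rfl | rfl
    exacts [(hfm z hz).1, hy, hw, hx]
  refine ⟨Q', x, c + f.length + 1, ?_, ?_, by omega, fun h => hx (h ▸ hsQ)⟩
  · intro j hj r hr
    by_cases hjJ : j ≤ J
    · obtain ⟨l, hl, hll⟩ := hQ j hjJ r hr
      refine ⟨_, join hl g1 hg1, ?_⟩
      simp only [List.length_append, List.length_singleton]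
      omega
    · obtain ⟨l, hl, hll⟩ := hQ J le_rfl r hr
      refine ⟨_, join hl g2 hg2, ?_⟩
      simp only [List.length_append, List.length_singleton]
      omega
  · have h1 := List.toFinset_card_le f
    have h2 := Finset.card_le_three (a := x) (b := w) (c := y)
    have h3 : Q'.card ≤ _ := Finset.card_union_le Q (f.toFinset ∪ {x, w, y})
    have h4 := Finset.card_union_le f.toFinset {x, w, y}
    omega

theorem Flexible.extend_five (hQ : Flexible G Q s e c 0 ε) (hG : Robust G n) (hQc : Q.card ≤ 11)
    (hc : c ≤ 6) :
    ∃ Q' e' c', Flexible G Q' s e' c' 5 ε ∧ Q'.card ≤ 51 ∧ c' ≤ 36 ∧ s ≠ e' := by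
  obtain ⟨Q1, e1, c1, h1, k1, d1, -⟩ := hQ.extend hG (by omega)
  obtain ⟨Q2, e2, c2, h2, k2, d2, -⟩ := h1.extend hG (by omega)
  obtain ⟨Q3, e3, c3, h3, k3, d3, -⟩ := h2.extend hG (by omega)
  obtain ⟨Q4, e4, c4, h4, k4, d4, -⟩ := h3.extend hG (by omega)
  obtain ⟨Q5, e5, c5, h5, k5, d5, hne⟩ := h4.extend hG (by omega)
  exact ⟨Q5, e5, c5, h5, by omega, by omega, hne⟩

theorem IsPathList.hasCycleLength_join (hl : IsPathList G Q s e l)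
    (hC : IsPathList G (Q \ {e, s})ᶜ e s C) (h3 : 3 ≤ C.length) (hes : s ≠ e) :
    HasCycleLength G (l.length + C.length - 2) := by
  have h0 := hC.getElem?_zero
  have h1 := hC.getElem?_last
  obtain ⟨b, hb⟩ : ∃ b, C[1]? = some b := ⟨_, List.getElem?_eq_getElem (by omega)⟩
  obtain ⟨b', hb'⟩ : ∃ b, C[C.length - 2]? = some b := ⟨_, List.getElem?_eq_getElem (by omega)⟩
  have hs := hC.slice hb hb' (by omega)
  have key := (hl.mono (W' := Finset.univ) (by simp)).append (hs.mono (by simp))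
    (hC.adj h0 hb) (by
      intro x hx hx'
      have h2 := hs.mem x hx'
      have h3 := hl.mem x hx
      obtain ⟨k, hk1, hk2, hk⟩ := mem_slice.1 hx'
      simp only [Finset.mem_compl, Finset.mem_sdiff, Finset.mem_insert, Finset.mem_singleton,
        not_and, not_not] at h2
      rcases h2 h3 with rfl | rfl
      · have := hC.nodup.index_eq hk h0
        omega
      · have := hC.nodup.index_eq hk h1
        omega)
  have hlen : (l ++ _root_.slice C 1 (C.length - 2)).length = l.length + C.length - 2 := by
    rw [List.length_append, length_slice (by omega)]
    omega
  have hl2 : 2 ≤ l.length := by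
    have := hl.length_pos
    by_contra! hlt
    have e1 := hl.getElem?_last
    rw [show l.length - 1 = 0 by omega, hl.getElem?_zero] at e1
    exact hes (Option.some.inj e1)
  rw [← hlen]
  refine key.hasCycleLength (by omega) (hC.adj hb' ?_)
  rw [show C.length - 2 + 1 = C.length - 1 by omega, h1]

theorem Robust.hasCycleLength (hG : Robust G n) (hm : Even m) (hnm : n + 1 ≤ m)
    (hmn : m + 4008 ≤ 2 * n) : HasCycleLength G m := by
  have hn := hG.large
  obtain ⟨ε, hε, Q, s, e, c, hQ, hQc, hc⟩ : ∃ ε : ℕ,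
      ((ε = 0 ∧ ∀ v (w : G.Walk v v), Even w.length) ∨ ε = 1) ∧
      ∃ Q s e c, Flexible G Q s e c 0 ε ∧ Q.card ≤ 11 ∧ c ≤ 6 := by
    by_cases hodd : ∃ v, ∃ w : G.Walk v v, Odd w.length
    · obtain ⟨v, w, hw⟩ := hodd
      exact ⟨1, Or.inr rfl, hG.exists_flexible_odd w hw⟩
    · push Not at hodd
      refine ⟨0, Or.inl ⟨rfl, fun v w => by simpa using hodd v w⟩, ?_⟩
      have := hG.le_card
      obtain ⟨v⟩ : Nonempty V := Fintype.card_pos_iff.1 (by omega)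
      refine ⟨{v}, v, v, 1, fun j hj r hr => ⟨[v], IsPathList.singleton G (by simp), ?_⟩, by simp,
        by simp⟩
      simp only [List.length_singleton]
      omega
  obtain ⟨Q, e, c, hQ, hQc, hc, hse⟩ := hQ.extend_five hG hQc hc
  obtain ⟨l0, hl0, hl0l⟩ := hQ 0 (Nat.zero_le _) 0 (Nat.zero_le _)
  have hWc : (Q \ {e, s})ᶜᶜ.card ≤ 49 := by
    rw [compl_compl, Finset.card_sdiff_of_subset, Finset.card_pair hse.symm]
    · omega
    · intro x hx
      rw [Finset.mem_insert, Finset.mem_singleton] at hx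
      rcases hx with rfl | rfl
      exacts [hl0.mem _ hl0.last_mem, hl0.mem _ hl0.head_mem]
  obtain ⟨C, hC, hC1, hC2⟩ := hG.exists_route (t := m - 8 - c) hWc (e := e) (s := s) (by simp)
    (by simp) hse.symm (by omega) (by omega)
  obtain ⟨j, r, hj, hr, hjr⟩ : ∃ j r, j ≤ 5 ∧ r ≤ ε ∧ m + 2 = C.length + (c + 2 * j + r) := by
    rcases hε with ⟨rfl, hev⟩ | rfl
    · obtain ⟨v, w, -, hw⟩ := hl0.hasCycleLength_join hC (by omega) hse
      have h1 := hev v w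
      rw [hw, hl0l] at h1
      refine ⟨(m + 2 - C.length - c) / 2, 0, by omega, le_rfl, ?_⟩
      grind
    · exact ⟨(m + 2 - C.length - c) / 2, (m + 2 - C.length - c) % 2, by omega, by omega, by omega⟩
  obtain ⟨l, hl, hll⟩ := hQ j hj r hr
  have := hl.hasCycleLength_join hC (by omega) hse
  rwa [show l.length + C.length - 2 = m by omega] at this

end Gadgets

section Separated

variable {V : Type*} [Fintype V] [DecidableEq V] {G : SimpleGraph V} {A B R T X Z : Finset V}
  {a b s s' u v x y z : V} {l : List V} {i j k m n t : ℕ}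

theorem exists_few_nonneighbors
    (hA : ∀ u ∈ A, ∀ v ∈ A, u ≠ v → (A \ (nbr G u ∪ nbr G v)).card ≤ 200) (hT : T ⊆ A)
    (hT3 : 3 ≤ T.card) (hR : R ⊆ A) (hRc : 1200 < R.card) :
    ∃ v ∈ T, 2 * (R \ nbr G v).card < R.card := by
  by_contra! hcon
  obtain ⟨f, hf, hfT⟩ := Finset.exists_injective_fin hT3
  have hpair : ∀ i j, i ≠ j → ((R \ nbr G (f i)) ∩ (R \ nbr G (f j))).card ≤ 200 := by
    intro i j hij
    refine (Finset.card_le_card ?_).trans (hA _ (hT (hfT i)) _ (hT (hfT j)) (hf.ne hij))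
    intro x hx
    simp only [Finset.mem_inter, Finset.mem_sdiff, Finset.mem_union, not_or] at hx ⊢
    exact ⟨hR hx.1.1, hx.1.2, hx.2.2⟩
  have h1 := Finset.card_union_add_card_inter (R \ nbr G (f 0)) (R \ nbr G (f 1))
  have h2 := Finset.card_union_add_card_inter (R \ nbr G (f 0) ∪ R \ nbr G (f 1))
    (R \ nbr G (f 2))
  have h3 : (R \ nbr G (f 0) ∪ R \ nbr G (f 1) ∪ R \ nbr G (f 2)).card ≤ R.card :=
    Finset.card_le_card (Finset.union_subset (Finset.union_subset Finset.sdiff_subset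
      Finset.sdiff_subset) Finset.sdiff_subset)
  rw [Finset.union_inter_distrib_right] at h2
  have h4 := Finset.card_union_le ((R \ nbr G (f 0)) ∩ (R \ nbr G (f 2)))
    ((R \ nbr G (f 1)) ∩ (R \ nbr G (f 2)))
  have := hpair 0 1 (by decide)
  have := hpair 0 2 (by decide)
  have := hpair 1 2 (by decide)
  have := hcon _ (hfT 0)
  have := hcon _ (hfT 1)
  have := hcon _ (hfT 2)
  omega

theorem card_inter_add_card_sdiff_nbr (R : Finset V) (v : V) :
    (nbr G v ∩ R).card + (R \ nbr G v).card = R.card := by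
  rw [Finset.inter_comm]
  exact Finset.card_inter_add_card_sdiff R (nbr G v)

theorem exists_greedy_path
    (hA : ∀ u ∈ A, ∀ v ∈ A, u ≠ v → (A \ (nbr G u ∪ nbr G v)).card ≤ 200)
    (hX : X.card ≤ 4) (ha : a ∈ A) (haX : a ∉ X) (hda : 100 ≤ (nbr G a ∩ A).card)
    (ht : t + 1210 ≤ A.card) :
    ∃ c l, IsPathList G (A \ X) a c l ∧ l.length = t + 1 ∧
      3 ≤ (nbr G c ∩ ((A \ X) \ l.toFinset)).card ∧
      (1 ≤ t → 2 * (((A \ X) \ l.toFinset) \ nbr G c).card < ((A \ X) \ l.toFinset).card) := by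
  induction t with
  | zero =>
    refine ⟨a, [a], IsPathList.singleton G (Finset.mem_sdiff.2 ⟨ha, haX⟩), rfl, ?_, by omega⟩
    have h1 := Finset.le_card_sdiff (insert a X) (nbr G a ∩ A)
    have h2 := Finset.card_insert_le a X
    have h3 : (nbr G a ∩ A) \ insert a X ⊆ nbr G a ∩ ((A \ X) \ [a].toFinset) := by
      intro x hx
      simp only [Finset.mem_inter, Finset.mem_sdiff, Finset.mem_insert, not_or, List.mem_toFinset,
        List.mem_singleton] at hx ⊢
      exact ⟨hx.1.1, ⟨hx.1.2, hx.2.2⟩, hx.2.1⟩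
    have := Finset.card_le_card h3
    omega
  | succ t ih =>
    obtain ⟨c, l, hl, hlt, h3, -⟩ := ih (by omega)
    have hRc : ((A \ X) \ l.toFinset).card + (t + 1 + 4) ≥ A.card := by
      have h1 := Finset.le_card_sdiff l.toFinset (A \ X)
      have h2 := Finset.le_card_sdiff X A
      have h3 := List.toFinset_card_le l
      omega
    obtain ⟨c', hc', hgood⟩ := exists_few_nonneighbors (T := nbr G c ∩ ((A \ X) \ l.toFinset))
      (R := (A \ X) \ l.toFinset) hA
      (fun x hx => by
        simp only [Finset.mem_inter, Finset.mem_sdiff] at hx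
        exact hx.2.1.1) h3
      (Finset.sdiff_subset.trans Finset.sdiff_subset) (by omega)
    simp only [Finset.mem_inter, Finset.mem_sdiff, mem_nbr, List.mem_toFinset] at hc'
    obtain ⟨hcc, ⟨hc'A, hc'X⟩, hc'l⟩ := hc'
    have hc'R : c' ∈ (A \ X) \ l.toFinset := by simp [hc'A, hc'X, hc'l]
    have hR' : (A \ X) \ (l ++ [c']).toFinset = ((A \ X) \ l.toFinset).erase c' := by
      ext x
      simp only [Finset.mem_sdiff, Finset.mem_erase, List.mem_toFinset, List.mem_append,
        List.mem_singleton]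
      tauto
    have e1 := Finset.card_erase_add_one hc'R
    have e2 := card_inter_add_card_sdiff_nbr (G := G) ((A \ X) \ l.toFinset) c'
    have e3 : nbr G c' ∩ ((A \ X) \ (l ++ [c']).toFinset) = nbr G c' ∩ ((A \ X) \ l.toFinset) := by
      ext x
      simp only [Finset.mem_inter, Finset.mem_sdiff, mem_nbr, List.mem_toFinset, List.mem_append,
        List.mem_singleton]
      have : G.Adj c' x → x ≠ c' := fun h => h.ne'
      tauto
    have e4 : (((A \ X) \ l.toFinset) \ nbr G c').erase c' =
        ((A \ X) \ l.toFinset).erase c' \ nbr G c' := by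
      ext x
      simp only [Finset.mem_sdiff, Finset.mem_erase]
      tauto
    have e5 := Finset.card_erase_add_one (s := ((A \ X) \ l.toFinset) \ nbr G c') (a := c')
      (by simp [hc'A, hc'X, hc'l])
    refine ⟨c', l ++ [c'], hl.append (IsPathList.singleton G (by simp [hc'A, hc'X])) hcc ?_,
      by simp [hlt], ?_, fun _ => ?_⟩
    · intro x hx hx'
      obtain rfl := List.mem_singleton.1 hx'
      exact hc'l hx
    · rw [e3]
      omega
    · rw [hR', ← e4]
      omega

theorem exists_path_of_few_nonneighbors
    (hA : ∀ u ∈ A, ∀ v ∈ A, u ≠ v → (A \ (nbr G u ∪ nbr G v)).card ≤ 200)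
    (ha : a ∈ A) (hb : b ∈ A) (hab : a ≠ b) (hda : 100 ≤ (nbr G a ∩ A).card)
    (hdb : 100 ≤ (nbr G b ∩ A).card) (ht5 : 5 ≤ t) (ht : t + 1310 ≤ A.card) :
    ∃ l, IsPathList G A a b l ∧ l.length = t := by
  obtain ⟨Y, hYs, hY3⟩ := Finset.exists_subset_card_eq (s := (nbr G b ∩ A).erase a) (n := 3) (by
    have := Finset.pred_card_le_card_erase (s := nbr G b ∩ A) (a := a)
    omega)
  have hYp : ∀ y ∈ Y, y ≠ a ∧ G.Adj b y ∧ y ∈ A := by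
    intro y hy
    simpa using hYs hy
  have haX : a ∉ insert b Y := by
    rw [Finset.mem_insert, not_or]
    exact ⟨hab, fun h => (hYp a h).1 rfl⟩
  have hX4 : (insert b Y).card ≤ 4 := (Finset.card_insert_le _ _).trans (by omega)
  obtain ⟨c, l, hl, hlt, -, hgood⟩ := exists_greedy_path (t := t - 4) hA hX4 ha haX hda (by omega)
  have hgood := hgood (by omega)
  have hRc : ((A \ insert b Y) \ l.toFinset).card + (t + 1) ≥ A.card := by
    have h1 := Finset.le_card_sdiff l.toFinset (A \ insert b Y)
    have h2 := Finset.le_card_sdiff (insert b Y) A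
    have h3 := List.toFinset_card_le l
    omega
  obtain ⟨y, hy, hygood⟩ := exists_few_nonneighbors (T := Y)
    (R := (A \ insert b Y) \ l.toFinset) hA (fun y hy => (hYp y hy).2.2) (by omega)
    (Finset.sdiff_subset.trans Finset.sdiff_subset) (by omega)
  set R := (A \ insert b Y) \ l.toFinset with hR
  obtain ⟨w, hw⟩ : (R \ ((R \ nbr G c) ∪ (R \ nbr G y))).Nonempty := by
    rw [← Finset.card_pos]
    have h1 := Finset.le_card_sdiff ((R \ nbr G c) ∪ (R \ nbr G y)) R
    have h2 := Finset.card_union_le (R \ nbr G c) (R \ nbr G y)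
    omega
  simp only [Finset.mem_sdiff, Finset.mem_union, mem_nbr, not_or, not_and, not_not] at hw
  obtain ⟨hwR, hwc, hwy⟩ := hw
  have hcw := hwc hwR
  have hyw := hwy hwR
  simp only [hR, Finset.mem_sdiff, Finset.mem_insert, not_or, List.mem_toFinset] at hwR
  obtain ⟨⟨hwA, hwb, hwY⟩, hwl⟩ := hwR
  have hlX : ∀ x ∈ l, x ∈ A ∧ x ≠ b ∧ x ∉ Y := by
    intro x hx
    simpa using hl.mem x hx
  have t1 := (IsPathList.singleton G (hYp y hy).2.2).append (IsPathList.singleton G hb)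
    (hYp y hy).2.1.symm (by simpa using (hYp y hy).2.1.ne')
  have t2 := (IsPathList.singleton G hwA).append t1 hyw.symm (by
    simpa using ⟨hyw.ne', hwb⟩)
  have t3 := (hl.mono fun x hx => (hlX x hx).1).append t2 hcw (by
    intro x hx hx'
    simp only [List.mem_append, List.mem_singleton] at hx'
    rcases hx' with rfl | rfl | rfl
    exacts [hwl hx, (hlX _ hx).2.2 hy, (hlX _ hx).2.1 rfl])
  refine ⟨_, t3, ?_⟩
  simp only [List.length_append, List.length_singleton]
  omega

/-- Any two vertices of `G` have at least `n - 1` neighbours, other than themselves, between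
them. -/
def PairCover (G : SimpleGraph V) (n : ℕ) : Prop :=
  ∀ u v, u ≠ v → n ≤ ((nbr G u ∪ nbr G v) \ {u, v}).card + 1

theorem PairCover.card_add_le (hP : PairCover G n) (huv : u ≠ v)
    (hX : ∀ x ∈ X, x ≠ u → x ≠ v → ¬ G.Adj u x ∧ ¬ G.Adj v x) :
    X.card + n ≤ Fintype.card V + 1 := by
  have hd : Disjoint X ((nbr G u ∪ nbr G v) \ {u, v}) := by
    rw [Finset.disjoint_left]
    intro x hx hx'
    simp only [Finset.mem_sdiff, Finset.mem_union, mem_nbr, Finset.mem_insert,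
      Finset.mem_singleton, not_or] at hx'
    have := hX x hx hx'.2.1 hx'.2.2
    tauto
  have h1 := Finset.card_le_univ (X ∪ ((nbr G u ∪ nbr G v) \ {u, v}))
  rw [Finset.card_union_of_disjoint hd] at h1
  have := hP u v huv
  omega

/-- `A` and `B` are disjoint sets of at least two vertices outside `Z` with no edge of `G`
between them. -/
structure Separated (G : SimpleGraph V) (Z A B : Finset V) : Prop where
  disj : Disjoint A B
  two_left : 2 ≤ A.card
  two_right : 2 ≤ B.card
  not_adj : ∀ x ∈ A, ∀ y ∈ B, ¬ G.Adj x y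
  left : Disjoint A Z
  right : Disjoint B Z

namespace Separated

theorem symm (h : Separated G Z A B) : Separated G Z B A :=
  ⟨h.disj.symm, h.two_right, h.two_left, fun x hx y hy e => h.not_adj y hy x hx e.symm, h.right,
    h.left⟩

theorem card_right_lt (h : Separated G Z A B) (hP : PairCover G n)
    (hV : Fintype.card V = 2 * n) : B.card + 1 ≤ n := by
  obtain ⟨u, hu, v, hv, huv⟩ := Finset.one_lt_card.1 h.two_left
  have h1 := hP.card_add_le (X := B ∪ {u, v}) huv (by
    intro x hx hxu hxv
    simp only [Finset.mem_union, Finset.mem_insert, Finset.mem_singleton, hxu, hxv, or_false]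
      at hx
    exact ⟨h.not_adj u hu x hx, h.not_adj v hv x hx⟩)
  rw [Finset.card_union_of_disjoint, Finset.card_pair huv] at h1
  · omega
  · rw [Finset.disjoint_right]
    intro x hx
    rw [Finset.mem_insert, Finset.mem_singleton] at hx
    rcases hx with rfl | rfl
    exacts [Finset.disjoint_left.1 h.disj hu, Finset.disjoint_left.1 h.disj hv]

theorem exists_path (h : Separated G Z A B) (hP : PairCover G n) (hV : Fintype.card V = 2 * n)
    (hn : 4511 ≤ n) (hdeg : ∀ v ∉ Z, n ≤ 2 * (nbr G v).card + 1)
    (hAB : 2 * n ≤ A.card + B.card + 200) (ha : a ∈ A) (hb : b ∈ A) (hab : a ≠ b) (ht5 : 5 ≤ t)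
    (ht : t + 1310 ≤ A.card) : ∃ l, IsPathList G A a b l ∧ l.length = t := by
  have hd : ∀ v ∈ A, 100 ≤ (nbr G v ∩ A).card := by
    intro v hv
    have h1 := hdeg v (Finset.disjoint_left.1 h.left hv)
    have h2 : nbr G v ⊆ (nbr G v ∩ A) ∪ (A ∪ B)ᶜ := by
      intro x hx
      have h3 := fun hxB => h.not_adj v hv x hxB (mem_nbr.1 hx)
      simp only [Finset.mem_union, Finset.mem_inter, Finset.mem_compl]
      tauto
    have h3 := (Finset.card_le_card h2).trans (Finset.card_union_le _ _)
    have h4 := Finset.card_compl_add_card (A ∪ B)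
    rw [Finset.card_union_of_disjoint h.disj] at h4
    omega
  refine exists_path_of_few_nonneighbors ?_ ha hb hab (hd a ha) (hd b hb) ht5 ht
  intro u hu v hv huv
  have h1 := hP.card_add_le (X := B ∪ A \ (nbr G u ∪ nbr G v)) huv (by
    intro x hx hxu hxv
    simp only [Finset.mem_union, Finset.mem_sdiff, mem_nbr, not_or] at hx
    rcases hx with hx | hx
    exacts [⟨h.not_adj u hu x hx, h.not_adj v hv x hx⟩, hx.2])
  rw [Finset.card_union_of_disjoint (h.disj.symm.mono_right Finset.sdiff_subset)] at h1
  have := h.symm.card_right_lt hP hV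
  omega

theorem hasCycleLength (h : Separated G Z A B) (hP : PairCover G n)
    (hV : Fintype.card V = 2 * n) (hn : 4511 ≤ n)
    (hdeg : ∀ v ∉ Z, n ≤ 2 * (nbr G v).card + 1) (hAB : 2 * n ≤ A.card + B.card + 200)
    (hs : s ∉ A ∪ B) (hs' : s' ∉ A ∪ B) (hss : s ≠ s')
    (hA : ∃ a ∈ A, ∃ a' ∈ A, a ≠ a' ∧ G.Adj s a ∧ G.Adj s' a')
    (hB : ∃ b ∈ B, ∃ b' ∈ B, b ≠ b' ∧ G.Adj s b ∧ G.Adj s' b') (hm : n ≤ m)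
    (hmn : m + 4008 ≤ 2 * n) : HasCycleLength G m := by
  obtain ⟨a, ha, a', ha', haa, hsa, hsa'⟩ := hA
  obtain ⟨b, hb, b', hb', hbb, hsb, hsb'⟩ := hB
  have h1 := h.card_right_lt hP hV
  have h2 := h.symm.card_right_lt hP hV
  obtain ⟨x, y, hx, hxA, hy, hyB, hxy⟩ : ∃ x y, 5 ≤ x ∧ x + 1310 ≤ A.card ∧ 5 ≤ y ∧
      y + 1310 ≤ B.card ∧ x + y + 2 = m :=
    ⟨m / 2 - 1, m - m / 2 - 1, by omega, by omega, by omega, by omega, by omega⟩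
  obtain ⟨p, hp, hpx⟩ := h.exists_path hP hV hn hdeg hAB ha ha' haa hx hxA
  obtain ⟨q, hq, hqy⟩ := h.symm.exists_path hP hV hn hdeg (by omega) hb' hb hbb.symm hy hyB
  rw [Finset.mem_union, not_or] at hs hs'
  have t1 := (IsPathList.singleton G (Finset.mem_univ s')).append
    (hq.mono (W' := Finset.univ) (by simp)) hsb' (by
      intro z hz hz'
      obtain rfl := List.mem_singleton.1 hz
      exact hs'.2 (hq.mem _ hz'))
  have t2 := (hp.mono (W' := Finset.univ) (by simp)).append t1 hsa'.symm (by
    intro z hz hz'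
    rcases List.mem_append.1 hz' with hz' | hz'
    · obtain rfl := List.mem_singleton.1 hz'
      exact hs'.1 (hp.mem _ hz)
    · exact Finset.disjoint_left.1 h.disj (hp.mem _ hz) (hq.mem _ hz'))
  have t3 := (IsPathList.singleton G (Finset.mem_univ s)).append t2 hsa (by
    intro z hz hz'
    obtain rfl := List.mem_singleton.1 hz
    rcases List.mem_append.1 hz' with hz' | hz'
    · exact hs.1 (hp.mem _ hz')
    · rcases List.mem_append.1 hz' with hz' | hz'
      · exact hss (List.mem_singleton.1 hz')
      · exact hs.2 (hq.mem _ hz'))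
  have hlen : ([s] ++ (p ++ ([s'] ++ q))).length = m := by
    simp only [List.length_append, List.length_singleton]
    omega
  rw [← hlen]
  exact t3.hasCycleLength (by omega) hsb.symm

theorem exists_adj_left (h : Separated G Z A B)
    (hmax : ∀ A' B', Separated G Z A' B' → A'.card + B'.card ≤ A.card + B.card)
    (hs : s ∉ A ∪ B) (hsZ : s ∉ Z) : ∃ a ∈ A, G.Adj s a := by
  by_contra! hcon
  rw [Finset.mem_union, not_or] at hs
  have h1 := hmax A (insert s B) ⟨Finset.disjoint_insert_right.2 ⟨hs.1, h.disj⟩, h.two_left,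
    h.two_right.trans (Finset.card_le_card (Finset.subset_insert _ _)), ?_, h.left,
    Finset.disjoint_insert_left.2 ⟨hsZ, h.right⟩⟩
  · rw [Finset.card_insert_of_notMem hs.2] at h1
    omega
  · intro x hx y hy e
    rcases Finset.mem_insert.1 hy with rfl | hy
    exacts [hcon x hx e.symm, h.not_adj x hx y hy e]

theorem exists_adj_pair_left (h : Separated G Z A B)
    (hmax : ∀ A' B', Separated G Z A' B' → A'.card + B'.card ≤ A.card + B.card)
    (hA3 : 3 ≤ A.card) (hs : s ∉ A ∪ B) (hsZ : s ∉ Z) (hs' : s' ∉ A ∪ B) (hsZ' : s' ∉ Z)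
    (hss : s ≠ s') : ∃ a ∈ A, ∃ a' ∈ A, a ≠ a' ∧ G.Adj s a ∧ G.Adj s' a' := by
  by_contra! hcon
  obtain ⟨a, ha, hsa⟩ := h.exists_adj_left hmax hs hsZ
  obtain ⟨a', ha', hsa'⟩ := h.exists_adj_left hmax hs' hsZ'
  obtain rfl : a = a' := by
    by_contra hne
    exact hcon a ha a' ha' hne hsa hsa'
  rw [Finset.mem_union, not_or] at hs hs'
  have h1 := Finset.card_erase_add_one ha
  have h2 : (insert s (insert s' B)).card = B.card + 2 := by
    rw [Finset.card_insert_of_notMem (by simp [hss, hs.2]), Finset.card_insert_of_notMem hs'.2]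
  have h3 := hmax (A.erase a) (insert s (insert s' B)) ⟨?_, by omega, by omega, ?_,
    h.left.mono_left (Finset.erase_subset _ _), ?_⟩
  · omega
  · rw [Finset.disjoint_insert_right, Finset.disjoint_insert_right]
    exact ⟨fun h' => hs.1 (Finset.mem_of_mem_erase h'), fun h' => hs'.1
      (Finset.mem_of_mem_erase h'), h.disj.mono_left (Finset.erase_subset _ _)⟩
  · intro x hx y hy e
    rw [Finset.mem_erase] at hx
    rw [Finset.mem_insert, Finset.mem_insert] at hy
    rcases hy with rfl | rfl | hy
    · exact hcon x hx.2 a ha hx.1 e.symm hsa'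
    · exact hcon a ha x hx.2 hx.1.symm hsa e.symm
    · exact h.not_adj x hx.2 y hy e
  · rw [Finset.disjoint_insert_left, Finset.disjoint_insert_left]
    exact ⟨hsZ, hsZ', h.right⟩

theorem exists_two_outside (h : Separated G Z A B) (hP : PairCover G n)
    (hV : Fintype.card V = 2 * n) (hn : 4511 ≤ n) (hZ : Z.card ≤ 1)
    (hlow : ∀ v ∈ Z, 2 * (nbr G v).card + 1 < n) : 2 ≤ ((A ∪ B)ᶜ \ Z).card := by
  by_contra! hlt
  have h1 := h.card_right_lt hP hV
  have h2 := h.symm.card_right_lt hP hV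
  have h3 := Finset.card_compl_add_card (A ∪ B)
  rw [Finset.card_union_of_disjoint h.disj] at h3
  have h4 := Finset.card_inter_add_card_sdiff (A ∪ B)ᶜ Z
  have h5 := Finset.card_le_card (Finset.inter_subset_right (s₁ := (A ∪ B)ᶜ) (s₂ := Z))
  obtain ⟨z, hz⟩ := Finset.card_pos.1 (show 0 < ((A ∪ B)ᶜ ∩ Z).card by omega)
  simp only [Finset.mem_inter, Finset.mem_compl, Finset.mem_union, not_or] at hz
  obtain ⟨⟨hzA, hzB⟩, hzZ⟩ := hz
  have h6 : (A \ nbr G z).card ≤ 1 := by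
    by_contra! hgt
    obtain ⟨u, hu, v, hv, huv⟩ := Finset.one_lt_card.1 hgt
    rw [Finset.mem_sdiff, mem_nbr] at hu hv
    have h7 := hP.card_add_le (X := B ∪ {z, u, v}) huv (by
      intro x hx hxu hxv
      simp only [Finset.mem_union, Finset.mem_insert, Finset.mem_singleton, hxu, hxv, or_false]
        at hx
      rcases hx with hx | rfl
      exacts [⟨h.not_adj u hu.1 x hx, h.not_adj v hv.1 x hx⟩,
        ⟨fun e => hu.2 e.symm, fun e => hv.2 e.symm⟩])
    rw [Finset.card_union_of_disjoint, Finset.card_eq_three.2 ⟨z, u, v, ?_, ?_, huv, rfl⟩] at h7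
    · omega
    · rintro rfl
      exact hzA hu.1
    · rintro rfl
      exact hzA hv.1
    · rw [Finset.disjoint_right]
      intro x hx
      simp only [Finset.mem_insert, Finset.mem_singleton] at hx
      rcases hx with rfl | rfl | rfl
      exacts [hzB, Finset.disjoint_left.1 h.disj hu.1, Finset.disjoint_left.1 h.disj hv.1]
  have h7 := card_inter_add_card_sdiff_nbr (G := G) A z
  have h8 := Finset.card_le_card (Finset.inter_subset_left (s₁ := nbr G z) (s₂ := A))
  have := hlow z hzZ
  omega

end Separated

theorem PairCover.hasCycleLength_of_separated (hP : PairCover G n)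
    (hV : Fintype.card V = 2 * n) (hn : 4511 ≤ n) (hZ : Z.card ≤ 1)
    (hlow : ∀ v ∈ Z, 2 * (nbr G v).card + 1 < n)
    (hdeg : ∀ v ∉ Z, n ≤ 2 * (nbr G v).card + 1) (h0 : Separated G Z A B)
    (hAB : 2 * n ≤ A.card + B.card + 200) (hm : n ≤ m) (hmn : m + 4008 ≤ 2 * n) :
    HasCycleLength G m := by
  classical
  obtain ⟨⟨A', B'⟩, h, hmax⟩ := Finset.exists_max_image
    (Finset.univ.filter fun p : Finset V × Finset V => Separated G Z p.1 p.2)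
    (fun p => p.1.card + p.2.card) ⟨(A, B), by simpa using h0⟩
  simp only [Finset.mem_filter, Finset.mem_univ, true_and, Prod.forall] at h hmax
  have hAB' := hmax A B h0
  have h1 := h.card_right_lt hP hV
  have h2 := h.symm.card_right_lt hP hV
  obtain ⟨s, hs, s', hs', hss⟩ := Finset.one_lt_card.1 (h.exists_two_outside hP hV hn hZ hlow)
  simp only [Finset.mem_sdiff, Finset.mem_compl] at hs hs'
  refine h.hasCycleLength hP hV hn hdeg (by omega) hs.1 hs'.1 hss
    (h.exists_adj_pair_left hmax (by omega) hs.1 hs.2 hs'.1 hs'.2 hss)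
    (h.symm.exists_adj_pair_left (fun A B hAB => ?_) (by omega) (Finset.union_comm A' B' ▸ hs.1)
      hs.2 (Finset.union_comm A' B' ▸ hs'.1) hs'.2 hss) hm hmn
  rw [add_comm B'.card]
  exact hmax A B hAB

end Separated

section UpperBound

variable {V : Type*} [Fintype V] [DecidableEq V] {G : SimpleGraph V} {W Z : Finset V} {m n : ℕ}

theorem nbr_comap_map (G : SimpleGraph V) (v : W) :
    (nbr (G.comap ((↑) : W → V)) v).map (Function.Embedding.subtype _) = nbr G v ∩ W := by
  ext x
  simp only [Finset.mem_map, mem_nbr, comap_adj, Function.Embedding.coe_subtype, Finset.mem_inter]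
  constructor
  · rintro ⟨y, hy, rfl⟩
    exact ⟨hy, y.2⟩
  · rintro ⟨hx, hxW⟩
    exact ⟨⟨x, hxW⟩, hx, rfl⟩

theorem hasCycleLength_of_comap (h : HasCycleLength (G.comap ((↑) : W → V)) m) :
    HasCycleLength G m := by
  obtain ⟨v, c, hc, hcm⟩ := h
  let f : G.comap ((↑) : W → V) →g G := ⟨Subtype.val, fun h => h⟩
  exact ⟨_, c.map f, (Walk.isCycle_map_iff_of_injective Subtype.val_injective).2 hc,
    (Walk.length_map _ _).trans hcm⟩

theorem PairCover.card_low_le (hP : PairCover G n)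
    (hlow : ∀ v ∈ Z, 2 * (nbr G v).card + 1 < n) : Z.card ≤ 1 := by
  refine Finset.card_le_one.2 fun u hu v hv => ?_
  by_contra huv
  have h1 := hP u v huv
  have h2 := Finset.card_le_card (Finset.sdiff_subset (s := nbr G u ∪ nbr G v) (t := {u, v}))
  have h3 := Finset.card_union_le (nbr G u) (nbr G v)
  have := hlow u hu
  have := hlow v hv
  omega

theorem PairCover.robust_comap (hP : PairCover G n) (hV : Fintype.card V = 2 * n)
    (hn : 4511 ≤ n) (hZ : Z.card ≤ 1) (hdeg : ∀ v ∉ Z, n ≤ 2 * (nbr G v).card + 1)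
    (hsep : ∀ A B, Separated G Z A B → A.card + B.card + 200 < 2 * n) :
    Robust (G.comap ((↑) : ↥Zᶜ → V)) n := by
  have hc : Fintype.card ↥Zᶜ + Z.card = 2 * n := by
    rw [Fintype.card_coe, Finset.card_compl_add_card, hV]
  have hZc : Zᶜᶜ.card ≤ 1 := by rwa [compl_compl]
  refine ⟨hn, by omega, by omega, fun v => ?_, fun u v huv => ?_, fun A B hd hA hB he => ?_⟩
  · have h1 := hdeg v (Finset.mem_compl.1 v.2)
    have h2 := card_le_card_inter_add (nbr G (v : V)) Zᶜ
    rw [← nbr_comap_map, Finset.card_map] at h2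
    omega
  · have h1 := hP u v (fun h => huv (Subtype.ext h))
    have h2 := Finset.card_le_card
      (Finset.sdiff_subset (s := nbr G (u : V) ∪ nbr G (v : V)) (t := {(u : V), (v : V)}))
    have h3 := card_le_card_inter_add (nbr G (u : V) ∪ nbr G (v : V)) Zᶜ
    rw [Finset.union_inter_distrib_right, ← nbr_comap_map, ← nbr_comap_map, ← Finset.map_union,
      Finset.card_map] at h3
    omega
  · have hout : ∀ A : Finset ↥Zᶜ, Disjoint (A.map (Function.Embedding.subtype _)) Z := by
      intro A
      rw [Finset.disjoint_left]
      intro x hx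
      obtain ⟨y, -, rfl⟩ := Finset.mem_map.1 hx
      exact Finset.mem_compl.1 y.2
    have h1 := hsep (A.map (Function.Embedding.subtype _)) (B.map (Function.Embedding.subtype _))
      ⟨(Finset.disjoint_map _).2 hd, by rwa [Finset.card_map], by rwa [Finset.card_map], ?_,
        hout A, hout B⟩
    · rw [Finset.card_map, Finset.card_map] at h1
      omega
    · intro x hx y hy
      obtain ⟨x', hx', rfl⟩ := Finset.mem_map.1 hx
      obtain ⟨y', hy', rfl⟩ := Finset.mem_map.1 hy
      exact he x' hx' y' hy'

theorem PairCover.hasCycleLength (hP : PairCover G n) (hV : Fintype.card V = 2 * n)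
    (hn : 4511 ≤ n) (hm : Even m) (hnm : n + 1 ≤ m) (hmn : m + 4008 ≤ 2 * n) :
    HasCycleLength G m := by
  classical
  set Z := Finset.univ.filter fun v => 2 * (nbr G v).card + 1 < n with hZdef
  have hlow : ∀ v ∈ Z, 2 * (nbr G v).card + 1 < n := fun v hv => by simpa [hZdef] using hv
  have hdeg : ∀ v ∉ Z, n ≤ 2 * (nbr G v).card + 1 := fun v hv => by simpa [hZdef] using hv
  have hZ := hP.card_low_le hlow
  by_cases hsep : ∃ A B, Separated G Z A B ∧ 2 * n ≤ A.card + B.card + 200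
  · obtain ⟨A, B, h, hAB⟩ := hsep
    exact hP.hasCycleLength_of_separated hV hn hZ hlow hdeg h hAB (by omega) hmn
  · push Not at hsep
    exact hasCycleLength_of_comap ((hP.robust_comap hV hn hZ hdeg hsep).hasCycleLength hm hnm hmn)

theorem pairCover_compl {Γ : SimpleGraph V} (hV : Fintype.card V = 2 * n)
    (hΓ : ¬ Contains Γ (completeBipartiteGraph (Fin 2) (Fin n))) : PairCover Γᶜ n := by
  intro u v huv
  by_contra! hlt
  have h1 := Finset.card_le_card_sdiff_add_card (s := nbr Γᶜ u ∪ nbr Γᶜ v) (t := {u, v})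
  have h2 := Finset.card_compl_add_card (((nbr Γᶜ u ∪ nbr Γᶜ v) \ {u, v}) ∪ {u, v})
  have h3 := Finset.card_union_le ((nbr Γᶜ u ∪ nbr Γᶜ v) \ {u, v}) {u, v}
  rw [Finset.card_pair huv] at h3
  obtain ⟨s, hs, hsT⟩ := Finset.exists_injective_fin (k := n)
    (T := (((nbr Γᶜ u ∪ nbr Γᶜ v) \ {u, v}) ∪ {u, v})ᶜ) (by omega)
  have key : ∀ i, s i ≠ u ∧ s i ≠ v ∧ Γ.Adj u (s i) ∧ Γ.Adj v (s i) := by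
    intro i
    have h4 := hsT i
    simp only [Finset.mem_compl, Finset.mem_union, Finset.mem_sdiff, mem_nbr, compl_adj,
      Finset.mem_insert, Finset.mem_singleton] at h4
    have e1 : s i = u ↔ u = s i := eq_comm
    have e2 : s i = v ↔ v = s i := eq_comm
    tauto
  refine hΓ ⟨⟨Sum.elim ![u, v] s, ?_⟩, ?_⟩
  · have hadj : ∀ i j, Γ.Adj (![u, v] i) (s j) := by
      intro i j
      fin_cases i
      exacts [(key j).2.2.1, (key j).2.2.2]
    rintro (i | i) (j | j) hij
    · simp at hij
    · exact hadj i j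
    · exact (hadj j i).symm
    · simp at hij
  · refine Function.Injective.sumElim ?_ hs ?_
    · intro i j hij
      fin_cases i <;> fin_cases j <;> simp_all
    · intro i j
      fin_cases i
      exacts [(key j).1.symm, (key j).2.1.symm]

end UpperBound

section LowerBound

variable {m n N : ℕ}

/-- The complete bipartite graph on the nonzero vertices below `n` and those from `n` on, the
vertex `0` being isolated. -/
def sideGraph (n N : ℕ) : SimpleGraph (Fin N) where
  Adj x y := x.val ≠ 0 ∧ y.val ≠ 0 ∧ ¬ (x.val < n ↔ y.val < n)
  symm := ⟨fun _ _ h => ⟨h.2.1, h.1, fun e => h.2.2 e.symm⟩⟩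
  loopless := ⟨fun _ h => h.2.2 Iff.rfl⟩

theorem card_side_lt (hn : 0 < n) (hN : N < 2 * n) (y : Fin N) {T : Finset (Fin N)}
    (hT : ∀ x ∈ T, x.val ≠ 0 ∧ (x.val < n ↔ y.val < n)) : T.card < n := by
  by_cases hy : y.val < n
  · have h1 : T.map Fin.valEmbedding ⊆ Finset.Ico 1 n := by
      intro i hi
      obtain ⟨x, hx, rfl⟩ := Finset.mem_map.1 hi
      have := hT x hx
      rw [Finset.mem_Ico, Fin.valEmbedding_apply]
      omega
    have h2 := Finset.card_le_card h1
    rw [Finset.card_map, Nat.card_Ico] at h2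
    omega
  · have h1 : T.map Fin.valEmbedding ⊆ Finset.Ico n N := by
      intro i hi
      obtain ⟨x, hx, rfl⟩ := Finset.mem_map.1 hi
      have := hT x hx
      rw [Finset.mem_Ico, Fin.valEmbedding_apply]
      omega
    have h2 := Finset.card_le_card h1
    rw [Finset.card_map, Nat.card_Ico] at h2
    omega

theorem not_contains_sideGraph (hn : 0 < n) (hN : N < 2 * n) :
    ¬ Contains (sideGraph n N) (completeBipartiteGraph (Fin 2) (Fin n)) := by
  rintro ⟨f, hf⟩
  have hadj : ∀ i, (sideGraph n N).Adj (f (Sum.inl 0)) (f (Sum.inr i)) := fun i =>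
    f.map_adj (by simp)
  have h1 := card_side_lt hn hN (f (Sum.inr ⟨0, hn⟩))
    (T := Finset.univ.image (f ∘ Sum.inr)) (by
      intro x hx
      obtain ⟨i, -, rfl⟩ := Finset.mem_image.1 hx
      have h2 := hadj i
      have h3 := hadj ⟨0, hn⟩
      exact ⟨h2.2.1, by have := h2.2.2; have := h3.2.2; tauto⟩)
  rw [Finset.card_image_of_injective _ (hf.comp Sum.inr_injective), Finset.card_univ,
    Fintype.card_fin] at h1
  exact h1.false

theorem not_hasCycleLength_compl_sideGraph (hn : 0 < n) (hN : N < 2 * n) (hm : n < m) :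
    ¬ HasCycleLength (sideGraph n N)ᶜ m := by
  rintro ⟨v, c, hc, hcm⟩
  obtain ⟨v, c, hc, hcm, h0⟩ : ∃ (v : Fin N) (c : (sideGraph n N)ᶜ.Walk v v), c.IsCycle ∧
      c.length = m ∧ ∀ i, 1 ≤ i → i < m → (c.getVert i).val ≠ 0 := by
    by_cases hz : ∃ z ∈ c.support, z.val = 0
    · obtain ⟨z, hz, hz0⟩ := hz
      refine ⟨z, c.rotate z hz, hc.rotate hz, by rw [Walk.length_rotate, hcm], ?_⟩
      intro i h1 h2 hi
      have h3 : (c.rotate z hz).getVert i = (c.rotate z hz).getVert 0 := by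
        rw [Walk.getVert_zero]
        exact Fin.ext (hi.trans hz0.symm)
      have h4 := (hc.rotate hz).getVert_injOn' (by simp; omega) (by simp) h3
      omega
    · push Not at hz
      exact ⟨v, c, hc, hcm, fun i _ _ => hz _ (Walk.getVert_mem_support _ _)⟩
  have hside : ∀ i, 1 ≤ i → i < m → ((c.getVert i).val < n ↔ (c.getVert 1).val < n) := by
    intro i hi
    induction i, hi using Nat.le_induction with
    | base => exact fun _ => Iff.rfl
    | succ i hi ih =>
      intro him
      have h1 := c.adj_getVert_succ (i := i) (by omega)
      rw [compl_adj] at h1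
      have h2 : ((c.getVert i).val < n ↔ (c.getVert (i + 1)).val < n) := by
        by_contra h
        exact h1.2 ⟨h0 i hi (by omega), h0 _ (by omega) him, h⟩
      exact h2.symm.trans (ih (by omega))
  have h1 := card_side_lt hn hN (c.getVert 1) (T := (Finset.Ico 1 m).image c.getVert) (by
    intro x hx
    obtain ⟨i, hi, rfl⟩ := Finset.mem_image.1 hx
    rw [Finset.mem_Ico] at hi
    exact ⟨h0 i hi.1 hi.2, hside i hi.1 hi.2⟩)
  rw [Finset.card_image_of_injOn, Nat.card_Ico] at h1
  · omega
  · refine hc.getVert_injOn.mono fun i hi => ?_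
    simp only [Finset.coe_Ico, Set.mem_Ico] at hi
    exact ⟨hi.1, by omega⟩

end LowerBound

theorem stmt_0 (n m : ℕ) (hn : 4511 ≤ n) (hm : Even m)
    (hm1 : n + 1 ≤ m) (hm2 : m ≤ 2 * n - 4008) :
    IsLeast {N | RamseyProp 2 n m N} (2 * n) := by
  refine ⟨fun Γ => ?_, fun N hN => ?_⟩
  · by_cases hΓ : Contains Γ (completeBipartiteGraph (Fin 2) (Fin n))
    · exact Or.inl hΓ
    · exact Or.inr ((pairCover_compl (Fintype.card_fin _) hΓ).hasCycleLength (Fintype.card_fin _)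
        hn hm hm1 (by omega))
  · by_contra! hlt
    rcases hN (sideGraph n N) with h | h
    · exact not_contains_sideGraph (by omega) hlt h
    · exact not_hasCycleLength_compl_sideGraph (by omega) hlt hm1 h
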